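/- arXiv:math/0305232 — 12 statements merged into one kernel-verified Lean document; each statement's English description precedes it below -/
import Mathlib

section
/- Let F be a field of characteristic 0 and n ≥ 2. If f : ℝⁿ → Fⁿ preserves unit distance, then f is injective. -/
/-- Squared distance `A` (rational) is preserved by `f`. -/
def PresSq {F : Type*} [Field F] {n : ℕ}
    (f : EuclideanSpace ℝ (Fin n) → (Fin n → F)) (A : ℚ) : Prop :=
  ∀ x y : EuclideanSpace ℝ (Fin n), dist x y ^ 2 = (A : ℝ) →
    ∑ i, (f x i - f y i) ^ 2 = (A : F)

/-- Algebraic core. -/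
lemma alg_core {F : Type*} [Field F] [CharZero F] {n : ℕ} (hn : 2 ≤ n)
    (A B C : F) (hA : A ≠ 0) (hC : C ≠ 0) (hABC : n * C = 4 * n * B - 2 * A * (n - 1))
    (w : Fin n → Fin n → F) (z : Fin n → F)
    (hB : ∀ i, w i ⬝ᵥ w i = B) (hw : ∀ i j, i ≠ j → w i ⬝ᵥ w j = B - A / 2)
    (hz : ∀ i, z ⬝ᵥ w i = (z ⬝ᵥ z) / 2) : z = 0 ∨ z ⬝ᵥ z = C := by
  have hn0 : (n : F) ≠ 0 := by
    have : n ≠ 0 := by omega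
    exact_mod_cast this
  have gram : ∀ (c : Fin n → F) (j : Fin n),
      (∑ i, c i • w i) ⬝ᵥ w j = A / 2 * c j + (B - A / 2) * ∑ i, c i := by
    intro c j
    rw [sum_dotProduct]
    have : ∀ i, (c i • w i) ⬝ᵥ w j = (if i = j then A / 2 * c j else 0) + (B - A / 2) * c i := by
      intro i
      rw [smul_dotProduct, smul_eq_mul]
      by_cases h : i = j
      · subst h; rw [hB]; simp; ring
      · rw [hw i j h]; simp [h]; ring
    simp_rw [this]
    rw [Finset.sum_add_distrib, ← Finset.mul_sum]
    simp
  have hli : LinearIndependent F w := by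
    rw [Fintype.linearIndependent_iff]
    intro c hc
    have h1 : ∀ j, A / 2 * c j + (B - A / 2) * ∑ i, c i = 0 := by
      intro j; rw [← gram, hc, zero_dotProduct]
    have h2 : ∑ j, (A / 2 * c j + (B - A / 2) * ∑ i, c i) = 0 :=
      Finset.sum_eq_zero (fun j _ => h1 j)
    rw [Finset.sum_add_distrib, ← Finset.mul_sum] at h2
    simp only [Finset.sum_const, Finset.card_univ, Fintype.card_fin, nsmul_eq_mul] at h2
    have h3 : n * C * ∑ i, c i = 0 := by rw [hABC]; linear_combination 4 * h2
    have h4 : ∑ i, c i = 0 := by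
      rcases mul_eq_zero.1 h3 with h | h
      · exact absurd h (mul_ne_zero hn0 hC)
      · exact h
    intro j
    have := h1 j
    rw [h4] at this
    simpa [hA] using this
  have hspan : Submodule.span F (Set.range w) = ⊤ :=
    hli.span_eq_top_of_card_eq_finrank' (by simp)
  obtain ⟨c, hc⟩ : ∃ c : Fin n → F, ∑ i, c i • w i = z := by
    have : z ∈ Submodule.span F (Set.range w) := by rw [hspan]; trivial
    exact (Submodule.mem_span_range_iff_exists_fun F).1 this
  have h1 : ∀ j, A / 2 * c j + (B - A / 2) * ∑ i, c i = (z ⬝ᵥ z) / 2 := by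
    intro j; rw [← gram, hc, hz]
  have h2 : z ⬝ᵥ z = (∑ i, c i) * ((z ⬝ᵥ z) / 2) := by
    have h0 : z ⬝ᵥ z = (∑ i, c i • w i) ⬝ᵥ z := by rw [hc]
    rw [sum_dotProduct] at h0
    rw [Finset.sum_mul]
    refine h0.trans ?_
    refine Finset.sum_congr rfl fun i _ => ?_
    rw [smul_dotProduct, smul_eq_mul, dotProduct_comm, hz]
  have h3 : ∑ j, (A / 2 * c j + (B - A / 2) * ∑ i, c i) = ∑ j : Fin n, (z ⬝ᵥ z) / 2 :=
    Finset.sum_congr rfl (fun j _ => h1 j)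
  rw [Finset.sum_add_distrib, ← Finset.mul_sum] at h3
  simp only [Finset.sum_const, Finset.card_univ, Fintype.card_fin, nsmul_eq_mul] at h3
  have h4 : n * C * ∑ i, c i = 2 * n * (z ⬝ᵥ z) := by rw [hABC]; linear_combination 4 * h3
  have h5 : C * ∑ i, c i = 2 * (z ⬝ᵥ z) := by
    apply mul_left_cancel₀ hn0; linear_combination h4
  by_cases hzz : z ⬝ᵥ z = 0
  · left
    rw [hzz] at h5 h1
    have h6 : ∑ i, c i = 0 := by simpa [hC] using h5
    rw [← hc]
    refine Finset.sum_eq_zero fun j _ => ?_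
    have := h1 j
    rw [h6] at this
    have : c j = 0 := by simpa [hA] using this
    rw [this, zero_smul]
  · right
    have h6 : ∑ i, c i = 2 := by
      apply mul_right_cancel₀ hzz; linear_combination (-2) * h2
    rw [h6] at h5
    apply mul_left_cancel₀ (two_ne_zero (α := F)); linear_combination -h5

/-- Triangle construction. -/
lemma exists_triangle {n : ℕ} (hn : 2 ≤ n) (x y : EuclideanSpace ℝ (Fin n)) (a b : ℝ)
    (ha : 0 ≤ a) (hb : 0 ≤ b) (hd : 0 < dist x y) (h1 : |a - b| ≤ dist x y)
    (h2 : dist x y ≤ a + b) : ∃ z, dist x z = a ∧ dist y z = b := by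
  set d := dist x y with hdd
  let i0 : Fin n := ⟨0, by omega⟩
  let i1 : Fin n := ⟨1, by omega⟩
  have h01 : i0 ≠ i1 := by simp [i0, i1]
  let e0 : EuclideanSpace ℝ (Fin n) := EuclideanSpace.single i0 1
  let e1 : EuclideanSpace ℝ (Fin n) := EuclideanSpace.single i1 1
  have n0 : inner ℝ e0 e0 = (1 : ℝ) := by simp [e0]
  have n1 : inner ℝ e1 e1 = (1 : ℝ) := by simp [e1]
  have n01 : inner ℝ e0 e1 = (0 : ℝ) := by
    rw [PiLp.inner_apply]; simp [e0, e1, h01, Pi.single_apply]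
  have key : ∀ s t : ℝ, ‖s • e0 + t • e1‖ ^ 2 = s ^ 2 + t ^ 2 := by
    intro s t
    rw [← real_inner_self_eq_norm_sq]
    simp only [inner_add_left, inner_add_right, inner_smul_left, inner_smul_right, n0, n1, n01,
      real_inner_comm e0 e1]
    simp [real_inner_comm e0 e1, n01]
    ring
  have hv : ‖d • e0‖ = ‖y - x‖ := by
    rw [norm_smul, ← dist_eq_norm, dist_comm y x, ← hdd]
    simp [e0, abs_of_pos hd]
  let L := Submodule.reflection (Submodule.span ℝ {d • e0 - (y - x)})ᗮ
  have hL : L (d • e0) = y - x := Submodule.reflection_sub hv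
  have hd2 : (a - b) ^ 2 ≤ d ^ 2 := by rw [← sq_abs]; gcongr
  have hd3 : d ^ 2 ≤ (a + b) ^ 2 := by gcongr
  let s := (a ^ 2 - b ^ 2 + d ^ 2) / (2 * d)
  have hs : 2 * d * s = a ^ 2 - b ^ 2 + d ^ 2 := by simp only [s]; field_simp
  have hsa : 0 ≤ a ^ 2 - s ^ 2 := by
    have : 0 ≤ (4 * d ^ 2) * (a ^ 2 - s ^ 2) := by
      have : (4 * d ^ 2) * (a ^ 2 - s ^ 2) = ((a + b) ^ 2 - d ^ 2) * (d ^ 2 - (a - b) ^ 2) := by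
        linear_combination (-(2 * d * s) - (a ^ 2 - b ^ 2 + d ^ 2)) * hs
      rw [this]
      exact mul_nonneg (by linarith) (by linarith)
    exact nonneg_of_mul_nonneg_right this (by positivity)
  let t := Real.sqrt (a ^ 2 - s ^ 2)
  have ht : t ^ 2 = a ^ 2 - s ^ 2 := Real.sq_sqrt hsa
  refine ⟨x + L (s • e0 + t • e1), ?_, ?_⟩
  · rw [← sq_eq_sq₀ dist_nonneg ha, dist_comm, dist_eq_norm, add_sub_cancel_left,
      LinearIsometryEquiv.norm_map, key]
    linarith
  · rw [← sq_eq_sq₀ dist_nonneg hb, dist_comm, dist_eq_norm]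
    have : x + L (s • e0 + t • e1) - y = L ((s - d) • e0 + t • e1) := by
      have : (s - d) • e0 + t • e1 = (s • e0 + t • e1) - d • e0 := by module
      rw [this, map_sub, hL]; abel
    rw [this, LinearIsometryEquiv.norm_map, key]
    linear_combination ht - hs

/-- Simplex construction. -/
lemma exists_simplex {n : ℕ} (hn : 2 ≤ n) (x y : EuclideanSpace ℝ (Fin n)) (A B : ℝ)
    (hA : 0 < A) (hABC : n * dist x y ^ 2 = 4 * n * B - 2 * A * (n - 1)) :
    ∃ p : Fin n → EuclideanSpace ℝ (Fin n), (∀ i j, i ≠ j → dist (p i) (p j) ^ 2 = A) ∧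
      (∀ i, dist x (p i) ^ 2 = B) ∧ (∀ i, dist y (p i) ^ 2 = B) := by
  have hn0 : (0 : ℝ) < n := by
    have : 0 < n := by omega
    exact_mod_cast this
  set d := dist x y with hdd
  let o : EuclideanSpace ℝ (Fin n) := WithLp.toLp 2 (fun _ => 1)
  let b : Fin n → EuclideanSpace ℝ (Fin n) := fun i => EuclideanSpace.single i 1
  have hoo : inner ℝ o o = (n : ℝ) := by rw [PiLp.inner_apply]; simp [o]
  have hob : ∀ i, inner ℝ o (b i) = (1 : ℝ) := by intro i; rw [PiLp.inner_apply]; simp [o, b, Pi.single_apply]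
  have hbo : ∀ i, inner ℝ (b i) o = (1 : ℝ) := by intro i; rw [PiLp.inner_apply]; simp [o, b, Pi.single_apply]
  have hbb : ∀ i, inner ℝ (b i) (b i) = (1 : ℝ) := by intro i; simp [b]
  have hbb' : ∀ i j, i ≠ j → inner ℝ (b i) (b j) = (0 : ℝ) := by
    intro i j h; rw [PiLp.inner_apply]; simp [b, h, Pi.single_apply]
  let k := d / Real.sqrt n
  have hk : k ^ 2 * n = d ^ 2 := by
    simp only [k]; rw [div_pow, Real.sq_sqrt hn0.le]; field_simp
  have hv : ‖k • o‖ = ‖x - y‖ := by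
    rw [← sq_eq_sq₀ (norm_nonneg _) (norm_nonneg _), ← dist_eq_norm, ← hdd,
      ← real_inner_self_eq_norm_sq]
    simp only [inner_smul_left, inner_smul_right, hoo]
    simp only [conj_trivial]
    linarith
  let L := Submodule.reflection (Submodule.span ℝ {k • o - (x - y)})ᗮ
  have hL : L (k • o) = x - y := Submodule.reflection_sub hv
  let r := Real.sqrt (A / 2)
  have hr : r ^ 2 = A / 2 := Real.sq_sqrt (by positivity)
  have key : ∀ i (c : ℝ), c ^ 2 * n = d ^ 2 / 4 →
      ‖r • (b i - (1 / n : ℝ) • o) + c • o‖ ^ 2 = B := by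
    intro i c hc
    rw [← real_inner_self_eq_norm_sq]
    simp only [inner_add_left, inner_add_right, inner_sub_left, inner_sub_right, inner_smul_left,
      inner_smul_right, hoo, hob, hbo, hbb, conj_trivial]
    have hB : B = d ^ 2 / 4 + A / 2 * (1 - 1 / n) := by
      field_simp; linarith
    rw [hB, ← hc, ← hr]
    field_simp
    ring
  refine ⟨fun i => (1 / 2 : ℝ) • (x + y) + L (r • (b i - (1 / n : ℝ) • o)), ?_, ?_, ?_⟩
  · intro i j hij
    rw [dist_eq_norm, add_sub_add_left_eq_sub, ← map_sub, LinearIsometryEquiv.norm_map]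
    have : r • (b i - (1 / n : ℝ) • o) - r • (b j - (1 / n : ℝ) • o) = r • (b i - b j) := by module
    rw [this, ← real_inner_self_eq_norm_sq]
    simp only [inner_sub_left, inner_sub_right, inner_smul_left,
      inner_smul_right, hbb, hbb' i j hij, hbb' j i hij.symm, conj_trivial]
    linear_combination 2 * hr
  · intro i
    rw [dist_comm, dist_eq_norm, ← key i (-(k / 2)) (by linear_combination hk / 4),
      ← LinearIsometryEquiv.norm_map L (_ + _), map_add]
    have : (-(k / 2)) • o = (-(1 / 2 : ℝ)) • (k • o) := by module
    rw [this, map_smul L _ (k • o), hL]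
    congr 2
    module
  · intro i
    rw [dist_comm, dist_eq_norm, ← key i (k / 2) (by linear_combination hk / 4),
      ← LinearIsometryEquiv.norm_map L (_ + _), map_add]
    have : (k / 2) • o = (1 / 2 : ℝ) • (k • o) := by module
    rw [this, map_smul L _ (k • o), hL]
    congr 2
    module

lemma pres_step {F : Type*} [Field F] [CharZero F] {n : ℕ} (hn : 2 ≤ n)
    (f : EuclideanSpace ℝ (Fin n) → (Fin n → F)) (A B C E : ℚ)
    (hA : 0 < A) (hC : 0 < C) (hE : 0 < E) (hEC : E ≤ 4 * C) (hne : E ≠ C)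
    (hABC : n * C = 4 * n * B - 2 * A * (n - 1))
    (pA : PresSq f A) (pB : PresSq f B) (pE : PresSq f E) : PresSq f C := by
  have hsymm : ∀ u v : Fin n → F, ∑ i, (u i - v i) ^ 2 = ∑ i, (v i - u i) ^ 2 := fun u v =>
    Finset.sum_congr rfl fun i _ => by ring
  have main : ∀ x y : EuclideanSpace ℝ (Fin n), dist x y ^ 2 = (C : ℝ) →
      f x = f y ∨ ∑ i, (f x i - f y i) ^ 2 = (C : F) := by
    intro x y hxy
    obtain ⟨p, hp, hx, hy⟩ := exists_simplex hn x y (A : ℝ) (B : ℝ) (by exact_mod_cast hA)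
      (by rw [hxy]; exact_mod_cast congrArg (Rat.cast : ℚ → ℝ) hABC)
    have qp := fun i j h => pA _ _ (hp i j h)
    have qx := fun i => pB _ _ (hx i)
    have qy := fun i => pB _ _ (hy i)
    have dp : ∀ u v : Fin n → F, ∑ i, (u i - v i) ^ 2 = (u - v) ⬝ᵥ (u - v) := by
      intro u v; simp [dotProduct, sq]
    have expand : ∀ u v : Fin n → F,
        (u - v) ⬝ᵥ (u - v) = u ⬝ᵥ u - 2 * (u ⬝ᵥ v) + v ⬝ᵥ v := by
      intro u v
      rw [sub_dotProduct, dotProduct_sub, dotProduct_sub, dotProduct_comm v u]; ring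
    have hw : ∀ i, (f (p i) - f x) ⬝ᵥ (f (p i) - f x) = (B : F) := by
      intro i; rw [← dp, hsymm, qx]
    have := alg_core hn (A : F) (B : F) (C : F) (by exact_mod_cast hA.ne')
      (by exact_mod_cast hC.ne')
      (by exact_mod_cast congrArg (Rat.cast : ℚ → F) hABC) (fun i => f (p i) - f x) (f y - f x)
      hw
      (by
        intro i j hij
        have h := qp i j hij
        rw [dp, ← sub_sub_sub_cancel_right _ _ (f x), expand, hw, hw] at h
        linear_combination -h / 2)
      (by
        intro i
        have h := qy i
        rw [dp, ← sub_sub_sub_cancel_right _ _ (f x), expand, hw] at h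
        linear_combination -h / 2)
    rcases this with h | h
    · left; exact (sub_eq_zero.1 h).symm
    · right; rw [hsymm, dp, h]
  intro x y hxy
  rcases main x y hxy with h | h
  swap
  · exact h
  exfalso
  have hCR : (0 : ℝ) < C := by exact_mod_cast hC
  have hER : (0 : ℝ) < E := by exact_mod_cast hE
  have hECR : (E : ℝ) ≤ 4 * C := by exact_mod_cast hEC
  have hd : 0 < dist x y := by
    rcases dist_nonneg.lt_or_eq (a := 0) (b := dist x y) with h | h
    · exact h
    · rw [← h] at hxy; norm_num at hxy; linarith [hxy]
  have hs : Real.sqrt E ≤ 2 * dist x y := by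
    rw [Real.sqrt_le_left (by positivity)]; nlinarith
  obtain ⟨z, hz1, hz2⟩ := exists_triangle hn x y (dist x y) (Real.sqrt E) hd.le
    (Real.sqrt_nonneg _) hd
    (by rw [abs_le]; constructor <;> linarith [Real.sqrt_nonneg (E : ℝ)])
    (by linarith [Real.sqrt_nonneg (E : ℝ)])
  have e1 := pE y z (by rw [hz2, Real.sq_sqrt hER.le])
  rw [← h] at e1
  rcases main x z (by rw [hz1, hxy]) with h' | h'
  · rw [h'] at e1
    simp at e1
    exact hE.ne' (by exact_mod_cast e1.symm)
  · rw [h'] at e1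
    exact hne (by exact_mod_cast e1.symm)

/-- **Theorem 2.** If `n ≥ 2` and `f : ℝⁿ → Fⁿ` preserves unit distance
(meaning `|x - y| = 1` implies `φₙ(f x, f y) = 1`, where
`φₙ(u, v) = ∑ᵢ (uᵢ - vᵢ)²`), then `f` is injective. -/
theorem stmt_0 (F : Type*) [Field F] [CharZero F] (n : ℕ) (hn : 2 ≤ n)
    (f : EuclideanSpace ℝ (Fin n) → (Fin n → F))
    (hf : ∀ x y : EuclideanSpace ℝ (Fin n), dist x y = 1 →
      ∑ i, (f x i - f y i) ^ 2 = 1) :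
    Function.Injective f := by
  have hnQ : (2 : ℚ) ≤ n := by exact_mod_cast hn
  have p1 : PresSq f 1 := by
    intro x y h
    have : dist x y = 1 := by
      have h' : dist x y ^ 2 = 1 ^ 2 := by rw [h]; norm_num
      exact (sq_eq_sq₀ dist_nonneg zero_le_one).1 h'
    rw [hf x y this]; norm_num
  obtain ⟨D, hD⟩ : ∃ D : ℚ, D = 2 + 2 / n := ⟨_, rfl⟩
  have hDn : n * D = 2 * n + 2 := by rw [hD]; field_simp
  have hD2 : 2 < D := by rw [hD]; have : (0 : ℚ) < 2 / n := by positivity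
                         linarith
  have pD : ∀ k : ℕ, PresSq f (D ^ k) := by
    intro k
    induction k with
    | zero => simpa using p1
    | succ k ih =>
      have hp : 0 < D ^ k := by positivity
      refine pres_step hn f (D ^ k) (D ^ k) (D ^ (k + 1)) (D ^ k) hp (by positivity) hp ?_ ?_ ?_
        ih ih ih
      · rw [pow_succ]; nlinarith
      · rw [pow_succ]; intro h; nlinarith
      · rw [pow_succ]; linear_combination D ^ k * hDn
  have pC : ∀ (k : ℕ) (A G : ℚ), PresSq f A → 0 < A → n * G = 2 * A * (n - 1) → G ≤ 4 →
      PresSq f (4 * D ^ (k + 1) - G) := by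
    intro k A G pA hA hG hG4
    have : 2 < D ^ (k + 1) := by
      have := one_le_pow₀ (n := k) (by linarith : (1 : ℚ) ≤ D)
      rw [pow_succ]; nlinarith
    refine pres_step hn f A (D ^ (k + 1)) _ 1 hA (by linarith) one_pos (by linarith) ?_ ?_
      pA (pD _) p1
    · intro h; linarith
    · linear_combination -hG
  obtain ⟨G, hG⟩ : ∃ G : ℚ, G = 2 * (1 - 1 / n) := ⟨_, rfl⟩
  have hinv : (0 : ℚ) < 1 / n := by positivity
  have hinv2 : (1 / n : ℚ) ≤ 1 / 2 := by gcongr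
  have hGn : n * G = 2 * 1 * (n - 1) := by rw [hG]; field_simp
  have hG0 : 0 < G := by rw [hG]; linarith
  have hDG : D * G ≤ 4 := by
    have : D * G = 4 - 4 * (1 / n) ^ 2 := by rw [hG, hD]; ring
    rw [this]; nlinarith
  have hGDG : G < D * G := by nlinarith
  intro x y hxy
  by_contra hne
  have hd : 0 < dist x y := dist_pos.2 hne
  obtain ⟨k, hk⟩ := pow_unbounded_of_one_lt (max (1 / dist x y ^ 2) (dist x y ^ 2) * 16 + 16)
    (by exact_mod_cast (by linarith : 1 < D) : (1 : ℝ) < (D : ℝ))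
  have hk1 : (D : ℝ) ^ k ≤ (D : ℝ) ^ (k + 1) :=
    pow_le_pow_right₀ (by exact_mod_cast (by linarith : 1 ≤ D)) (by omega)
  have pa := pC k 1 G p1 one_pos hGn (by linarith)
  have pb := pC k D (D * G) (by simpa using pD 1) (by linarith)
    (by linear_combination D * hGn) hDG
  have hG0R : (0 : ℝ) < G := by exact_mod_cast hG0
  have hDGR : (D : ℝ) * G ≤ 4 := by exact_mod_cast hDG
  have hGDGR : (G : ℝ) < D * G := by exact_mod_cast hGDG
  set d := dist x y with hdd
  set M : ℝ := (D : ℝ) ^ (k + 1) with hM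
  have hM1 : 1 / d ^ 2 * 16 + 16 ≤ M := by
    have := le_max_left (1 / d ^ 2) (d ^ 2); linarith
  have hM2 : d ^ 2 * 16 + 16 ≤ M := by
    have := le_max_right (1 / d ^ 2) (d ^ 2); linarith
  have hdpos : 0 < 1 / d ^ 2 := by positivity
  obtain ⟨a, ha⟩ : ∃ a, a = Real.sqrt (4 * M - G) := ⟨_, rfl⟩
  obtain ⟨b, hb⟩ : ∃ b, b = Real.sqrt (4 * M - D * G) := ⟨_, rfl⟩
  have ha0 : 0 ≤ a := ha ▸ Real.sqrt_nonneg _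
  have hb0 : 0 ≤ b := hb ▸ Real.sqrt_nonneg _
  have ha2 : a ^ 2 = 4 * M - G := by rw [ha]; exact Real.sq_sqrt (by linarith)
  have hb2 : b ^ 2 = 4 * M - D * G := by rw [hb]; exact Real.sq_sqrt (by linarith)
  have hab : b ≤ a := by
    rw [← sq_le_sq₀ hb0 ha0]; linarith
  have hda : d ≤ a := by
    rw [← sq_le_sq₀ hd.le ha0]; nlinarith
  have had : 4 ≤ a * d := by
    rw [← sq_le_sq₀ (by norm_num) (by positivity), mul_pow, ha2]
    have h1 : 1 / d ^ 2 * d ^ 2 = 1 := by field_simp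
    have h2 : 1 / d ^ 2 * 16 ≤ 4 * M - G := by linarith
    nlinarith [mul_le_mul_of_nonneg_right h2 (sq_nonneg d)]
  have hsub : a - b ≤ d := by
    by_contra hcon
    push Not at hcon
    have : a * d < (a + b) * (a - b) := by
      nlinarith [mul_nonneg hb0 (sub_nonneg.2 hab), mul_lt_mul_of_pos_left hcon (by linarith : 0 < a)]
    nlinarith
  obtain ⟨z, hz1, hz2⟩ := exists_triangle hn x y a b ha0 hb0 hd
    (by rw [abs_of_nonneg (by linarith)]; exact hsub) (by linarith)
  have e1 := pa x z (by rw [hz1, ha2, hM]; push_cast; ring)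
  have e2 := pb y z (by rw [hz2, hb2, hM]; push_cast; ring)
  rw [hxy, e2] at e1
  have e3 : (4 * D ^ (k + 1) - D * G : ℚ) = 4 * D ^ (k + 1) - G := by exact_mod_cast e1
  linarith
end

section
/- Let F be a field of characteristic 0 and n ≥ 2. If f : ℝⁿ → Fⁿ preserves unit distance, and x,y ∈ ℝⁿ with x ≠ y, then φ_n(f(x),f(y)) ≠ 0; that is, f preserves the relation that two distinct points are at nonzero 'distance' (Theorem 4). -/
namespace UnitDist

open Matrix

/-- Scalars killed by the regular Gram matrix vanish. -/
lemma core {F : Type*} [Field F] {m : ℕ} (c : Fin m → F) (s h : F) (hh : h ≠ 0)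
    (hd : h + m * s ≠ 0) (H : ∀ j, c j * h + s * ∑ i, c i = 0) : ∀ j, c j = 0 := by
  have h1 : (h + m * s) * ∑ i, c i = 0 := by
    have : ∑ j, (c j * h + s * ∑ i, c i) = 0 := Finset.sum_eq_zero (fun j _ => H j)
    rw [Finset.sum_add_distrib, ← Finset.sum_mul] at this
    simp only [Finset.sum_const, Finset.card_univ, Fintype.card_fin, nsmul_eq_mul] at this
    linear_combination this
  have h2 : ∑ i, c i = 0 := by
    rcases mul_eq_zero.mp h1 with h | h
    · exact absurd h hd
    · exact h
  intro j
  have := H j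
  rw [h2, mul_zero, add_zero] at this
  rcases mul_eq_zero.mp this with h | h
  · exact h
  · exact absurd h hh

lemma perp_zero {F : Type*} [Field F] {n : ℕ} (w : Fin n → Fin n → F)
    (hw : LinearIndependent F w) (v : Fin n → F) (hv : ∀ i, w i ⬝ᵥ v = 0) : v = 0 := by
  have hu : IsUnit (Matrix.of w) := by
    rw [← Matrix.linearIndependent_rows_iff_isUnit]
    exact hw
  have hinj := Matrix.mulVec_injective_iff_isUnit.mpr hu
  apply hinj
  rw [Matrix.mulVec_zero]
  funext i
  exact hv i

/-- dot product of a combination with a member of a regular family -/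
lemma dot_comb {F : Type*} [Field F] {n m : ℕ} (w : Fin m → Fin n → F) (s h : F)
    (hg : ∀ i j, w i ⬝ᵥ w j = s + if i = j then h else 0) (c : Fin m → F) (j : Fin m) :
    (∑ i, c i • w i) ⬝ᵥ w j = c j * h + s * ∑ i, c i := by
  rw [sum_dotProduct]
  simp only [smul_dotProduct, hg, smul_eq_mul, mul_add, Finset.sum_add_distrib, mul_ite,
    mul_zero, Finset.sum_ite_eq', Finset.mem_univ, if_true]
  rw [← Finset.sum_mul]
  ring

/-- Gram entries from distances. -/
lemma gram {F : Type*} [Field F] [CharZero F] {n m : ℕ} (Z : Fin m → Fin n → F) (p : Fin n → F)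
    (s t : F) (h1 : ∀ i, ∑ k, (Z i k - p k) ^ 2 = s)
    (h2 : ∀ i j, i ≠ j → ∑ k, (Z i k - Z j k) ^ 2 = t) (i j : Fin m) :
    (Z i - p) ⬝ᵥ (Z j - p) = (s - t / 2) + if i = j then t / 2 else 0 := by
  have hd : ∀ i, (Z i - p) ⬝ᵥ (Z i - p) = s := by
    intro i
    rw [← h1 i]
    simp [dotProduct, sq]
  split_ifs with hij
  · subst hij
    rw [hd]; ring
  · have h3 : ((Z i - p) - (Z j - p)) ⬝ᵥ ((Z i - p) - (Z j - p)) = t := by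
      rw [← h2 i j hij]
      simp [dotProduct, sq]
    have hi := hd i
    have hj := hd j
    generalize Z i - p = a at h3 hi ⊢
    generalize Z j - p = b at h3 hj ⊢
    rw [sub_dotProduct, dotProduct_sub, dotProduct_sub, hi, hj, dotProduct_comm b a] at h3
    linear_combination (-1/2 : F) * h3

/-- Equidistance gives a dot product relation. -/
lemma equi {F : Type*} [Field F] {n : ℕ} (z p q : Fin n → F) (s : F)
    (h1 : ∑ k, (z k - p k) ^ 2 = s) (h2 : ∑ k, (z k - q k) ^ 2 = s) :
    2 * ((z - p) ⬝ᵥ (q - p)) = (q - p) ⬝ᵥ (q - p) := by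
  have e1 : (z - p) ⬝ᵥ (z - p) = s := by rw [← h1]; simp [dotProduct, sq]
  have e2 : ((z - p) - (q - p)) ⬝ᵥ ((z - p) - (q - p)) = s := by
    rw [← h2]; simp [dotProduct, sq]
  generalize z - p = a at e1 e2 ⊢
  generalize q - p = b at e2 ⊢
  rw [sub_dotProduct, dotProduct_sub, dotProduct_sub, e1, dotProduct_comm b a] at e2
  linear_combination (-1 : F) * e2

lemma bipyramid {F : Type*} [Field F] [CharZero F] {n : ℕ} (hn : n ≠ 0) (Z : Fin n → Fin n → F)
    (p q : Fin n → F) (s t e : F) (ht : t ≠ 0) (he : e ≠ 0)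
    (hste : n * e = 4 * n * s - 2 * (n - 1) * t)
    (h1 : ∀ i, ∑ k, (Z i k - p k) ^ 2 = s) (h1' : ∀ i, ∑ k, (Z i k - q k) ^ 2 = s)
    (h2 : ∀ i j, i ≠ j → ∑ k, (Z i k - Z j k) ^ 2 = t) :
    q = p ∨ ∑ k, (p k - q k) ^ 2 = e := by
  have hn' : (n : F) ≠ 0 := Nat.cast_ne_zero.mpr hn
  have hg := gram Z p s t h1 h2
  set w : Fin n → Fin n → F := fun i => Z i - p with hw
  have hg' : ∀ i j, w i ⬝ᵥ w j = (s - t / 2) + if i = j then t / 2 else 0 := hg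
  have hdet : t / 2 + n * (s - t / 2) = n * e / 4 := by
    linear_combination (-1/4 : F) * hste
  have hdet0 : t / 2 + n * (s - t / 2) ≠ 0 := by
    rw [hdet]
    exact div_ne_zero (mul_ne_zero hn' he) (by norm_num)
  have ht2 : t / 2 ≠ 0 := div_ne_zero ht (by norm_num)
  have hli : LinearIndependent F w := by
    rw [Fintype.linearIndependent_iff]
    intro c hc
    apply core c (s - t / 2) (t / 2) ht2 hdet0
    intro j
    rw [← dot_comb w _ _ hg' c j, hc, zero_dotProduct]
  set v := q - p with hv
  set τ := v ⬝ᵥ v with hτ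
  have hvw : ∀ i, 2 * (w i ⬝ᵥ v) = τ := fun i => equi (Z i) p q s (h1 i) (h1' i)
  set W : Fin n → F := ∑ i, (1 : F) • w i with hW
  have hWw : ∀ i, W ⬝ᵥ w i = n * e / 4 := by
    intro i
    rw [hW, dot_comb w _ _ hg' (fun _ => 1) i]
    simp only [Finset.sum_const, Finset.card_univ, Fintype.card_fin, nsmul_eq_mul]
    rw [← hdet]; ring
  have hWW : W ⬝ᵥ W = n * (n * e / 4) := by
    conv_lhs => rw [hW]
    rw [← hW, sum_dotProduct]
    simp only [one_smul]
    simp only [dotProduct_comm _ W, hWw]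
    simp
  have hvW : v = (2 * τ / (n * e)) • W := by
    rw [← sub_eq_zero]
    apply perp_zero w hli
    intro i
    rw [dotProduct_sub, dotProduct_smul, dotProduct_comm _ W, hWw, smul_eq_mul]
    have := hvw i
    field_simp
    linear_combination 2 * this
  have hq : τ * (τ - e) = 0 := by
    have h5 : τ = (2 * τ / (n * e)) * ((2 * τ / (n * e)) * (W ⬝ᵥ W)) := by
      conv_lhs => rw [hτ, hvW]
      rw [smul_dotProduct, dotProduct_smul, smul_eq_mul, smul_eq_mul]
    rw [hWW] at h5
    field_simp at h5
    linear_combination (-1/4 : F) * h5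
  rcases mul_eq_zero.mp hq with h | h
  · left
    rw [h] at hvW
    simp only [mul_zero, zero_div, zero_smul] at hvW
    exact sub_eq_zero.mp hvW
  · right
    rw [← sub_eq_zero.mp h, hτ, hv]
    simp only [dotProduct, Pi.sub_apply]
    exact Finset.sum_congr rfl (fun k _ => by ring)

lemma isotropic {F : Type*} [Field F] [CharZero F] {m : ℕ} (Z : Fin m → Fin (m + 1) → F)
    (p q : Fin (m + 1) → F) (s t : F) (ht : t ≠ 0) (hd : t / 2 + m * (s - t / 2) ≠ 0)
    (h1 : ∀ i, ∑ k, (Z i k - p k) ^ 2 = s) (h1' : ∀ i, ∑ k, (Z i k - q k) ^ 2 = s)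
    (h2 : ∀ i j, i ≠ j → ∑ k, (Z i k - Z j k) ^ 2 = t)
    (h0 : ∑ k, (p k - q k) ^ 2 = 0) : q = p := by
  have hg := gram Z p s t h1 h2
  set w : Fin m → Fin (m + 1) → F := fun i => Z i - p with hw
  have hg' : ∀ i j, w i ⬝ᵥ w j = (s - t / 2) + if i = j then t / 2 else 0 := hg
  have ht2 : t / 2 ≠ 0 := div_ne_zero ht (by norm_num)
  set v := q - p with hv
  have hvv : v ⬝ᵥ v = 0 := by
    rw [← h0]
    simp only [hv, dotProduct, Pi.sub_apply]
    exact Finset.sum_congr rfl (fun k _ => by ring)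
  have hvw : ∀ i, w i ⬝ᵥ v = 0 := by
    intro i
    have := equi (Z i) p q s (h1 i) (h1' i)
    change 2 * (w i ⬝ᵥ v) = v ⬝ᵥ v at this
    rw [hvv] at this
    simpa using this
  by_contra hne
  have hv0 : v ≠ 0 := fun h => hne (sub_eq_zero.mp h)
  apply hv0
  apply perp_zero (Fin.cons v w : Fin (m + 1) → Fin (m + 1) → F)
  · rw [Fintype.linearIndependent_iff]
    intro c hc
    rw [Fin.sum_univ_succ] at hc
    simp only [Fin.cons_zero, Fin.cons_succ] at hc
    have hc1 : ∀ j, c (Fin.succ j) = 0 := by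
      apply core (fun j => c (Fin.succ j)) (s - t / 2) (t / 2) ht2 hd
      intro j
      rw [← dot_comb w _ _ hg' (fun j => c (Fin.succ j)) j]
      have := congrArg (fun u => u ⬝ᵥ w j) hc
      simp only [add_dotProduct, smul_dotProduct, dotProduct_comm v, hvw, smul_zero, zero_add,
        zero_dotProduct] at this
      exact this
    have hc0 : c 0 = 0 := by
      simp only [hc1, zero_smul, Finset.sum_const_zero, add_zero] at hc
      rcases smul_eq_zero.mp hc with h | h
      · exact h
      · exact absurd h hv0
    intro i
    refine Fin.cases hc0 hc1 i
  · intro i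
    refine Fin.cases ?_ ?_ i
    · simpa using hvv
    · intro j
      simpa using hvw j

/-! Real geometry -/

/-- A linear isometry sending one unit vector to another. -/
lemma exists_isom {n : ℕ} (a u : EuclideanSpace ℝ (Fin n)) (h : ‖a‖ = ‖u‖) :
    ∃ T : EuclideanSpace ℝ (Fin n) ≃ₗᵢ[ℝ] EuclideanSpace ℝ (Fin n), T a = u :=
  ⟨_, Submodule.reflection_sub h⟩

lemma norm_single_sub {n : ℕ} {i j : Fin n} (h : i ≠ j) :
    ‖(EuclideanSpace.single i 1 - EuclideanSpace.single j 1 : EuclideanSpace ℝ (Fin n))‖ ^ 2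
      = 2 := by
  rw [norm_sub_sq_real, PiLp.norm_single, PiLp.norm_single]
  simp [EuclideanSpace.inner_single_left, h]
  norm_num

/-- Regular simplex equidistant from two points. -/
lemma geo1 {n : ℕ} (hn : n ≠ 0) (x y : EuclideanSpace ℝ (Fin n)) (s t e : ℝ) (ht : 0 < t)
    (he : 0 < e) (hste : n * e = 4 * n * s - 2 * (n - 1) * t) (hxy : dist x y ^ 2 = e) :
    ∃ Z : Fin n → EuclideanSpace ℝ (Fin n), (∀ i, dist (Z i) x ^ 2 = s) ∧
      (∀ i, dist (Z i) y ^ 2 = s) ∧ ∀ i j, i ≠ j → dist (Z i) (Z j) ^ 2 = t := by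
  have hn' : (0 : ℝ) < n := Nat.cast_pos.mpr (Nat.pos_of_ne_zero hn)
  set a : EuclideanSpace ℝ (Fin n) := WithLp.toLp 2 (fun _ => Real.sqrt (e / n)) with ha
  have hae : ‖a‖ = ‖x - y‖ := by
    rw [dist_eq_norm] at hxy
    rw [← sq_eq_sq₀ (norm_nonneg _) (norm_nonneg _), hxy, EuclideanSpace.real_norm_sq_eq]
    simp only [ha, Real.sq_sqrt (div_pos he hn').le]
    simp
    field_simp
  obtain ⟨T, hT⟩ := exists_isom a (x - y) hae
  obtain ⟨l, hl⟩ : ∃ l : ℝ, l ^ 2 = t / 2 := ⟨Real.sqrt (t / 2), Real.sq_sqrt (by linarith)⟩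
  have hr : Real.sqrt (e / n) ^ 2 = e / n := Real.sq_sqrt (div_pos he hn').le
  have hr0 : 0 < Real.sqrt (e / n) := Real.sqrt_pos.mpr (div_pos he hn')
  set r := Real.sqrt (e / n) with hrdef
  let E : Fin n → EuclideanSpace ℝ (Fin n) := fun i => EuclideanSpace.single i 1
  let b : Fin n → EuclideanSpace ℝ (Fin n) := fun i => l • (E i - (1 / (n * r)) • a)
  have key : ∀ (κ : ℝ), κ ^ 2 = 1 / 4 → ∀ i, ‖b i + κ • a‖ ^ 2 = s := by
    intro κ hκ i
    rw [EuclideanSpace.real_norm_sq_eq]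
    have h1 : ∀ k, (b i + κ • a) k ^ 2 =
        (if k = i then l ^ 2 - 2 * l * (l / n - κ * r) else 0) + (l / n - κ * r) ^ 2 := by
      intro k
      simp only [b, E, ha, PiLp.add_apply, PiLp.smul_apply, PiLp.sub_apply, smul_eq_mul,
        PiLp.single_apply]
      split_ifs
      · field_simp
        ring
      · field_simp
        ring
    simp only [h1, Finset.sum_add_distrib, Finset.sum_ite_eq', Finset.mem_univ, if_true,
      Finset.sum_const, Finset.card_univ, Fintype.card_fin, nsmul_eq_mul]
    have h2 : l ^ 2 - 2 * l * (l / n - κ * r) + n * (l / n - κ * r) ^ 2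
        = l ^ 2 * (1 - 1 / n) + κ ^ 2 * (n * r ^ 2) := by
      field_simp
      ring
    rw [h2, hl, hκ, hr]
    field_simp
    linear_combination 2 * hste
  have hmx : ∀ i, ((1 / 2 : ℝ) • (x + y) + T (b i)) - x = T (b i + (-(1/2) : ℝ) • a) := by
    intro i
    rw [map_add, map_smul T _ a, hT]
    module
  have hmy : ∀ i, ((1 / 2 : ℝ) • (x + y) + T (b i)) - y = T (b i + ((1/2) : ℝ) • a) := by
    intro i
    rw [map_add, map_smul T _ a, hT]
    module
  refine ⟨fun i => (1 / 2 : ℝ) • (x + y) + T (b i), ?_, ?_, ?_⟩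
  · intro i
    rw [dist_eq_norm, hmx, T.norm_map]
    exact key _ (by norm_num) i
  · intro i
    rw [dist_eq_norm, hmy, T.norm_map]
    exact key _ (by norm_num) i
  · intro i j hij
    have h1 : ((1 / 2 : ℝ) • (x + y) + T (b i)) - ((1 / 2 : ℝ) • (x + y) + T (b j)) = T (l • (E i - E j)) := by
      rw [add_sub_add_left_eq_sub, ← map_sub]
      congr 1
      simp only [b]
      module
    rw [dist_eq_norm, h1, T.norm_map, norm_smul, mul_pow, Real.norm_eq_abs, sq_abs, hl,
      norm_single_sub hij]
    norm_num

/-- Triangle with prescribed squared sides. -/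
lemma geo3 {m : ℕ} (x y : EuclideanSpace ℝ (Fin (m + 2))) (A B R : ℝ)
    (hR : 0 < R) (hxy : dist x y ^ 2 = R) (h : (A - B + R) ^ 2 ≤ 4 * R * A) :
    ∃ z, dist z x ^ 2 = A ∧ dist z y ^ 2 = B := by
  set r := dist x y with hr
  have hr0 : 0 < r := by
    rcases (dist_nonneg : 0 ≤ dist x y).lt_or_eq with h | h
    · exact h
    · exfalso
      rw [hr, ← h] at hxy
      simp at hxy
      linarith
  obtain ⟨T, hT⟩ := exists_isom (EuclideanSpace.single 0 r) (y - x) (by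
    rw [PiLp.norm_single, Real.norm_eq_abs, abs_of_pos hr0, hr, dist_comm, dist_eq_norm])
  obtain ⟨α, hα⟩ : ∃ α : ℝ, α = (A - B + R) / (2 * r) := ⟨_, rfl⟩
  have hα2 : α ^ 2 ≤ A := by
    rw [hα, div_pow, div_le_iff₀ (by positivity), mul_pow, hxy]
    linarith
  obtain ⟨β, hβ⟩ : ∃ β : ℝ, β ^ 2 = A - α ^ 2 := ⟨Real.sqrt (A - α ^ 2), Real.sq_sqrt (by linarith)⟩
  have key : ∀ γ : ℝ, ‖(EuclideanSpace.single 0 γ + EuclideanSpace.single 1 β :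
      EuclideanSpace ℝ (Fin (m + 2)))‖ ^ 2 = γ ^ 2 + β ^ 2 := by
    intro γ
    rw [EuclideanSpace.real_norm_sq_eq, Fin.sum_univ_succ, Fin.sum_univ_succ]
    simp [PiLp.single_apply, Fin.ext_iff]
  refine ⟨x + T (EuclideanSpace.single 0 α + EuclideanSpace.single 1 β), ?_, ?_⟩
  · rw [dist_eq_norm, add_sub_cancel_left, T.norm_map, key, hβ]
    ring
  · have : x + T (EuclideanSpace.single 0 α + EuclideanSpace.single 1 β) - y
        = T (EuclideanSpace.single 0 (α - r) + EuclideanSpace.single 1 β) := by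
      have h1 : (EuclideanSpace.single 0 (α - r) : EuclideanSpace ℝ (Fin (m + 2)))
          = EuclideanSpace.single 0 α - EuclideanSpace.single 0 r := by
        ext k
        simp only [PiLp.sub_apply, PiLp.single_apply]
        split_ifs <;> simp
      rw [h1, map_add, map_add, map_sub, hT]
      abel
    rw [dist_eq_norm, this, T.norm_map, key, hβ]
    have : 2 * r * α = A - B + R := by
      rw [hα]
      field_simp
    linear_combination hxy - this

/-- A unit simplex in the bisector far from both points. -/
lemma geo2 {m : ℕ} (x y : EuclideanSpace ℝ (Fin (m + 2))) (A : ℝ)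
    (hA1 : 1 ≤ A) (h : dist x y ^ 2 / 4 + 1 / 2 ≤ A) :
    ∃ Z : Fin (m + 1) → EuclideanSpace ℝ (Fin (m + 2)), (∀ i, dist (Z i) x ^ 2 = A) ∧
      (∀ i, dist (Z i) y ^ 2 = A) ∧ ∀ i j, i ≠ j → dist (Z i) (Z j) ^ 2 = 1 := by
  set r := dist x y with hr
  have hr0 : 0 ≤ r := dist_nonneg
  obtain ⟨T, hT⟩ := exists_isom (EuclideanSpace.single 0 r) (x - y) (by
    rw [PiLp.norm_single, Real.norm_eq_abs, abs_of_nonneg hr0, hr, dist_eq_norm])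
  obtain ⟨l, hl, hl0⟩ : ∃ l : ℝ, l ^ 2 = 1 / 2 ∧ 0 ≤ l :=
    ⟨Real.sqrt (1 / 2), Real.sq_sqrt (by norm_num), Real.sqrt_nonneg _⟩
  obtain ⟨q, hq⟩ : ∃ q : ℝ, r ^ 2 / 4 + 1 / 2 + 2 * l * q + (m + 1) * q ^ 2 = A := by
    have hc : ContinuousOn (fun q : ℝ => r ^ 2 / 4 + 1 / 2 + 2 * l * q + (m + 1) * q ^ 2)
      (Set.Icc 0 A) := by fun_prop
    have hA0 : (0 : ℝ) ≤ A := by linarith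
    have hm := intermediate_value_Icc hA0 hc
    obtain ⟨q, -, hq⟩ := hm (show A ∈ _ by
      constructor
      · simpa using h
      · have : (0 : ℝ) ≤ m := Nat.cast_nonneg m
        have h1 : 0 ≤ l * A := mul_nonneg hl0 hA0
        have h2 : 0 ≤ m * A ^ 2 := by positivity
        nlinarith [sq_nonneg r])
    exact ⟨q, hq⟩
  let b : Fin (m + 1) → ℝ → EuclideanSpace ℝ (Fin (m + 2)) := fun i κ =>
    WithLp.toLp 2 (Fin.cons κ (fun k => (if k = i then l else 0) + q))
  have key : ∀ i κ, κ ^ 2 = r ^ 2 / 4 → ‖b i κ‖ ^ 2 = A := by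
    intro i κ hκ
    rw [EuclideanSpace.real_norm_sq_eq, Fin.sum_univ_succ]
    have h1 : ∀ k : Fin (m + 1), (b i κ) (Fin.succ k) ^ 2 =
        (if k = i then l ^ 2 + 2 * l * q else 0) + q ^ 2 := by
      intro k
      simp only [b, Fin.cons_succ]
      split_ifs <;> ring
    have h0 : (b i κ) 0 = κ := rfl
    simp only [h1, h0, Finset.sum_add_distrib, Finset.sum_ite_eq', Finset.mem_univ, if_true,
      Finset.sum_const, Finset.card_univ, Fintype.card_fin, nsmul_eq_mul]
    rw [hκ, hl, ← hq]
    push_cast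
    ring
  have hb2 : ∀ (i) (κ : ℝ), b i 0 + κ • EuclideanSpace.single 0 r = b i (κ * r) := by
    intro i κ
    ext k
    refine Fin.cases ?_ (fun j => ?_) k
    · simp [b]
    · simp [b]
  refine ⟨fun i => (1 / 2 : ℝ) • (x + y) + T (b i 0), ?_, ?_, ?_⟩
  · intro i
    have : ((1 / 2 : ℝ) • (x + y) + T (b i 0)) - x = T (b i (-(1/2) * r)) := by
      rw [← hb2, map_add, map_smul T, hT]
      module
    rw [dist_eq_norm, this, T.norm_map]
    exact key _ _ (by ring)
  · intro i
    have : ((1 / 2 : ℝ) • (x + y) + T (b i 0)) - y = T (b i ((1/2) * r)) := by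
      rw [← hb2, map_add, map_smul T, hT]
      module
    rw [dist_eq_norm, this, T.norm_map]
    exact key _ _ (by ring)
  · intro i j hij
    have h1 : ((1 / 2 : ℝ) • (x + y) + T (b i 0)) - ((1 / 2 : ℝ) • (x + y) + T (b j 0)) =
        T (l • (EuclideanSpace.single (Fin.succ i) 1 - EuclideanSpace.single (Fin.succ j) 1)) := by
      rw [add_sub_add_left_eq_sub, ← map_sub]
      congr 1
      ext k
      refine Fin.cases ?_ (fun k => ?_) k
      · simp [b]
      · simp only [b, PiLp.sub_apply, PiLp.smul_apply, PiLp.single_apply, Fin.cons_succ,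
          Fin.succ_inj, smul_eq_mul]
        split_ifs <;> ring
    rw [dist_eq_norm, h1, T.norm_map, norm_smul, mul_pow, Real.norm_eq_abs, sq_abs, hl,
      norm_single_sub (by simpa using hij)]
    norm_num

/-- The squared distance `q` is preserved by `f`. -/
def Good {F : Type*} [Field F] {n : ℕ} (f : EuclideanSpace ℝ (Fin n) → (Fin n → F)) (q : ℚ) :
    Prop :=
  ∀ x y : EuclideanSpace ℝ (Fin n), dist x y ^ 2 = (q : ℝ) → ∑ i, (f x i - f y i) ^ 2 = (q : F)

lemma good_step {F : Type*} [Field F] [CharZero F] {m : ℕ}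
    (f : EuclideanSpace ℝ (Fin (m + 2)) → (Fin (m + 2) → F)) (h1 : Good f 1) (s t e : ℚ)
    (hs : Good f s) (ht : Good f t) (ht0 : 0 < t) (he : 1 < e)
    (hste : (m + 2) * e = 4 * (m + 2) * s - 2 * (m + 1) * t) : Good f e := by
  have heR : (1 : ℝ) < e := by exact_mod_cast he
  have hsteR : ((m : ℝ) + 2) * e = 4 * (m + 2) * s - 2 * (m + 1) * t := by exact_mod_cast hste
  have hsteF : ((m : F) + 2) * e = 4 * (m + 2) * s - 2 * (m + 1) * t := by exact_mod_cast hste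
  have alt : ∀ x y : EuclideanSpace ℝ (Fin (m + 2)), dist x y ^ 2 = (e : ℝ) →
      f y = f x ∨ ∑ i, (f x i - f y i) ^ 2 = (e : F) := by
    intro x y hxy
    obtain ⟨Z, hx, hy, hz⟩ := geo1 (by omega) x y s t e (by exact_mod_cast ht0) (by linarith)
      (by push_cast; linear_combination hsteR) hxy
    exact bipyramid (by omega) (fun i => f (Z i)) (f x) (f y) s t e
      (by exact_mod_cast ht0.ne') (by exact_mod_cast (by linarith : (0:ℚ) < e).ne')
      (by push_cast; linear_combination hsteF)
      (fun i => hs _ _ (hx i)) (fun i => hs _ _ (hy i)) (fun i j hij => ht _ _ (hz i j hij))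
  intro x y hxy
  rcases alt x y hxy with h | h
  · exfalso
    obtain ⟨z, hzx, hzy⟩ := geo3 x y e 1 e (by linarith) hxy (by nlinarith)
    have h3 : ∑ i, (f z i - f y i) ^ 2 = 1 := by
      simpa using h1 z y (by simpa using hzy)
    rw [h] at h3
    rcases alt z x hzx with h4 | h4
    · rw [h4] at h3
      simp at h3
    · rw [h4] at h3
      have : e = 1 := by exact_mod_cast h3
      linarith
  · exact h

end UnitDist

open UnitDist in
/-- **Theorem 4.** If `n ≥ 2`, `f : ℝⁿ → Fⁿ` preserves unit distance, and
`x ≠ y`, then `φₙ(f x, f y) ≠ 0`, where `φₙ(u, v) = ∑ᵢ (uᵢ - vᵢ)²`. -/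
theorem stmt_1 (F : Type*) [Field F] [CharZero F] (n : ℕ) (hn : 2 ≤ n)
    (f : EuclideanSpace ℝ (Fin n) → (Fin n → F))
    (hf : ∀ x y : EuclideanSpace ℝ (Fin n), dist x y = 1 →
      ∑ i, (f x i - f y i) ^ 2 = 1)
    (x y : EuclideanSpace ℝ (Fin n)) (hxy : x ≠ y) :
    ∑ i, (f x i - f y i) ^ 2 ≠ 0 := by
  obtain ⟨m, rfl⟩ : ∃ m, n = m + 2 := ⟨n - 2, by omega⟩
  intro h0
  have g1 : Good f 1 := by
    intro a b hab
    have : dist a b = 1 := by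
      rw [Rat.cast_one] at hab
      have : 0 ≤ dist a b := dist_nonneg
      nlinarith
    simpa using hf a b this
  obtain ⟨d, hd⟩ : ∃ d : ℚ, d = 2 + 2 / (m + 2) := ⟨_, rfl⟩
  have hm0 : (0 : ℚ) ≤ m := Nat.cast_nonneg m
  have hm2 : (0 : ℚ) < m + 2 := by linarith
  have hdm : (m + 2) * d = 2 * (m + 2) + 2 := by rw [hd]; field_simp
  have hd2 : 2 < d := by rw [hd]; have : 0 < 2 / ((m : ℚ) + 2) := by positivity
                         linarith
  have hd3 : d ≤ 3 := by nlinarith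
  have hpow1 : ∀ k : ℕ, 1 ≤ d ^ k := fun k => one_le_pow₀ (by linarith)
  have gpow : ∀ k : ℕ, Good f (d ^ k) := by
    intro k
    induction k with
    | zero => simpa using g1
    | succ k ih =>
      apply good_step f g1 (d ^ k) (d ^ k) _ ih ih (by linarith [hpow1 k])
      · rw [pow_succ]; nlinarith [hpow1 k]
      · rw [pow_succ]; linear_combination d ^ k * hdm
  -- `4 - d = 2 (m+1)/(m+2)`
  have gA : ∀ k : ℕ, Good f (4 * d ^ k - (4 - d)) := by
    intro k
    apply good_step f g1 (d ^ k) 1 _ (gpow k) g1 one_pos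
    · linarith [hpow1 k]
    · linear_combination hdm
  have gB : ∀ k : ℕ, Good f (4 * d ^ (k + 1) - (4 - d) * d) := by
    intro k
    apply good_step f g1 (d ^ (k + 1)) d _ (gpow (k + 1)) (by simpa using gpow 1) (by linarith)
    · rw [pow_succ]; nlinarith [hpow1 k]
    · linear_combination d * hdm
  have hdR2 : (2 : ℝ) < d := by exact_mod_cast hd2
  have hdR3 : (d : ℝ) ≤ 3 := by exact_mod_cast hd3
  have large : ∀ C : ℝ, ∃ k : ℕ, C < (d : ℝ) ^ (k + 1) := by
    intro C
    obtain ⟨k, hk⟩ := pow_unbounded_of_one_lt C (by linarith : (1 : ℝ) < d)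
    refine ⟨k, hk.trans_le ?_⟩
    exact pow_le_pow_right₀ (by linarith) (by omega)
  have hR : 0 < dist x y ^ 2 := by
    have := dist_pos.mpr hxy
    positivity
  -- first, `f x = f y`
  have heq : f y = f x := by
    obtain ⟨k, hk⟩ := large (dist x y ^ 2 / 4 + 1)
    obtain ⟨Z, hx, hy, hz⟩ := geo2 x y ((d : ℝ) ^ (k + 1)) (by linarith) (by linarith)
    refine isotropic (fun i => f (Z i)) (f x) (f y) ((d : F) ^ (k + 1)) 1 one_ne_zero ?_ ?_ ?_ ?_ h0
    · have : (0 : ℚ) < 1 / 2 + ((m : ℚ) + 1) * (d ^ (k + 1) - 1 / 2) := by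
        have := hpow1 (k + 1)
        nlinarith
      have h2 := this.ne'
      have h3 : (((1 / 2 + ((m : ℚ) + 1) * (d ^ (k + 1) - 1 / 2) : ℚ)) : F) ≠ 0 :=
        Rat.cast_ne_zero.mpr h2
      push_cast at h3 ⊢
      exact h3
    · intro i
      simpa using gpow (k + 1) (Z i) x (by simpa using hx i)
    · intro i
      simpa using gpow (k + 1) (Z i) y (by simpa using hy i)
    · intro i j hij
      simpa using g1 (Z i) (Z j) (by simpa using hz i j hij)
  -- second, `f x ≠ f y`
  obtain ⟨R, hRdef⟩ : ∃ R, R = dist x y ^ 2 := ⟨_, rfl⟩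
  rw [← hRdef] at hR
  obtain ⟨k, hk⟩ := large ((4 + R) ^ 2 / (4 * R) + 1)
  have hgap0 : 0 ≤ (4 - (d : ℝ)) * (d - 1) := by nlinarith
  have hgap4 : (4 - (d : ℝ)) * (d - 1) ≤ 4 := by nlinarith
  obtain ⟨z, hzx, hzy⟩ := geo3 x y (((4 * d ^ (k + 1) - (4 - d) : ℚ)) : ℝ)
    (((4 * d ^ (k + 1) - (4 - d) * d : ℚ)) : ℝ) R hR hRdef.symm (by
      push_cast
      have hA : (4 + R) ^ 2 ≤ (4 * R) * (4 * (d : ℝ) ^ (k + 1) - (4 - d)) := by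
        rw [← div_le_iff₀' (by positivity)]
        have : 0 ≤ (4 + R) ^ 2 / (4 * R) := by positivity
        linarith
      refine le_trans ?_ hA
      apply pow_le_pow_left₀
      · nlinarith
      · nlinarith)
  have e1 := gA (k + 1) z x hzx
  have e2 := gB k z y hzy
  rw [heq, e1] at e2
  have e3 : 4 * d ^ (k + 1) - (4 - d) = 4 * d ^ (k + 1) - (4 - d) * d := by exact_mod_cast e2
  nlinarith
end

section
/- Let F be a field of characteristic 0. If x,y ∈ ℝ² and |x−y|² is a rational number, then there exists a finite set S ⊆ ℝ² with {x,y} ⊆ S such that every map f : S → F² that preserves unit distance satisfies φ₂(f(x),f(y)) = |x−y|² (Theorem 3). -/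
namespace BQ

/-- Squared distance in coordinates. -/
def dsq {K : Type*} [Field K] (p q : K × K) : K := (p.1 - q.1) ^ 2 + (p.2 - q.2) ^ 2

/-- The filter of maps that preserve unit distance on large finite sets. -/
def L (F : Type*) [Field F] : Filter (ℝ × ℝ → F × F) where
  sets := {P | ∃ S : Finset (ℝ × ℝ), ∀ f : ℝ × ℝ → F × F,
    (∀ u ∈ S, ∀ v ∈ S, dsq u v = 1 → dsq (f u) (f v) = 1) → f ∈ P}
  univ_sets := ⟨∅, fun _ _ => trivial⟩
  sets_of_superset := by
    rintro P Q ⟨S, hS⟩ h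
    exact ⟨S, fun f hf => h (hS f hf)⟩
  inter_sets := by
    classical
    rintro P Q ⟨S, hS⟩ ⟨T, hT⟩
    refine ⟨S ∪ T, fun f hf => ⟨hS f ?_, hT f ?_⟩⟩
    · intro u hu v hv
      exact hf u (Finset.mem_union_left _ hu) v (Finset.mem_union_left _ hv)
    · intro u hu v hv
      exact hf u (Finset.mem_union_right _ hu) v (Finset.mem_union_right _ hv)

/-- The squared distance `q` is forced. -/
def Good (F : Type*) [Field F] (q : ℚ) : Prop :=
  ∀ x y : ℝ × ℝ, dsq x y = (q : ℝ) → ∀ᶠ f in L F, dsq (f x) (f y) = (q : F)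

section algebra
variable {F : Type*} [Field F] [CharZero F]

lemma zero_of_perp {v1 v2 c1 c2 d1 d2 : F} (h1 : v1 * c1 + v2 * c2 = 0)
    (h2 : v1 * d1 + v2 * d2 = 0) (h : c1 * d2 - c2 * d1 ≠ 0) : v1 = 0 ∧ v2 = 0 := by
  constructor
  · apply mul_left_cancel₀ h
    linear_combination d2 * h1 - c2 * h2
  · apply mul_left_cancel₀ h
    linear_combination c1 * h2 - d1 * h1

lemma rhombus {p q x y : F × F} {a b : F} (hb : b ≠ 0) (hpq : dsq p q = b)
    (h1 : dsq x p = a) (h2 : dsq x q = a) (h3 : dsq y p = a) (h4 : dsq y q = a) :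
    x = y ∨ dsq x y = 4 * a - b := by
  obtain ⟨p1, p2⟩ := p
  obtain ⟨q1, q2⟩ := q
  obtain ⟨x1, x2⟩ := x
  obtain ⟨y1, y2⟩ := y
  simp only [dsq] at *
  -- either difference or the sum relative to the midpoint vanishes
  have hx : (2 * x1 - p1 - q1) * (q1 - p1) + (2 * x2 - p2 - q2) * (q2 - p2) = 0 := by
    linear_combination h1 - h2
  have hy : (2 * y1 - p1 - q1) * (q1 - p1) + (2 * y2 - p2 - q2) * (q2 - p2) = 0 := by
    linear_combination h3 - h4
  set s := (2 * x2 - p2 - q2) * (q1 - p1) - (2 * x1 - p1 - q1) * (q2 - p2) with hs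
  set t := (2 * y2 - p2 - q2) * (q1 - p1) - (2 * y1 - p1 - q1) * (q2 - p2) with ht
  have ex1 : (2 * x1 - p1 - q1) * b = -s * (q2 - p2) := by
    rw [← hpq, hs]; linear_combination (q1 - p1) * hx
  have ex2 : (2 * x2 - p2 - q2) * b = s * (q1 - p1) := by
    rw [← hpq, hs]; linear_combination (q2 - p2) * hx
  have ey1 : (2 * y1 - p1 - q1) * b = -t * (q2 - p2) := by
    rw [← hpq, ht]; linear_combination (q1 - p1) * hy
  have ey2 : (2 * y2 - p2 - q2) * b = t * (q1 - p1) := by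
    rw [← hpq, ht]; linear_combination (q2 - p2) * hy
  have nx : (2 * x1 - p1 - q1) ^ 2 + (2 * x2 - p2 - q2) ^ 2 = 4 * a - b := by
    linear_combination 2 * h1 + 2 * h2 - hpq
  have ny : (2 * y1 - p1 - q1) ^ 2 + (2 * y2 - p2 - q2) ^ 2 = 4 * a - b := by
    linear_combination 2 * h3 + 2 * h4 - hpq
  have s2 : s ^ 2 = (4 * a - b) * b := by
    rw [← nx, ← hpq, hs]
    linear_combination (-(2 * x1 - p1 - q1) * (q1 - p1) - (2 * x2 - p2 - q2) * (q2 - p2)) * hx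
  have t2 : t ^ 2 = (4 * a - b) * b := by
    rw [← ny, ← hpq, ht]
    linear_combination (-(2 * y1 - p1 - q1) * (q1 - p1) - (2 * y2 - p2 - q2) * (q2 - p2)) * hy
  have two : (2 : F) ≠ 0 := two_ne_zero
  have h2b : (2 : F) * b ≠ 0 := mul_ne_zero two hb
  clear_value s t
  rcases sq_eq_sq_iff_eq_or_eq_neg.1 (s2.trans t2.symm) with h | h
  · left
    subst h
    ext
    · apply mul_left_cancel₀ h2b; linear_combination ex1 - ey1
    · apply mul_left_cancel₀ h2b; linear_combination ex2 - ey2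
  · right
    subst h
    have e1 : 2 * y1 = 2 * (p1 + q1) - 2 * x1 := by
      apply mul_left_cancel₀ hb; linear_combination ey1 + ex1
    have e2 : 2 * y2 = 2 * (p2 + q2) - 2 * x2 := by
      apply mul_left_cancel₀ hb; linear_combination ey2 + ex2
    have e1' : y1 = p1 + q1 - x1 := by
      apply mul_left_cancel₀ two; linear_combination e1
    have e2' : y2 = p2 + q2 - x2 := by
      apply mul_left_cancel₀ two; linear_combination e2
    rw [← nx, e1', e2']; ring

lemma lattice {A B M C D : F × F} {a : F} (ha : a ≠ 0)
    (hAM : dsq A M = a) (hBM : dsq B M = a) (hAC : dsq A C = a) (hCM : dsq C M = a)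
    (hCD : dsq C D = a) (hDM : dsq D M = a) (hBD : dsq B D = a)
    (hAD : dsq A D = 3 * a) (hBC : dsq B C = 3 * a) : dsq A B = 4 * a := by
  obtain ⟨A1, A2⟩ := A
  obtain ⟨B1, B2⟩ := B
  obtain ⟨M1, M2⟩ := M
  obtain ⟨C1, C2⟩ := C
  obtain ⟨D1, D2⟩ := D
  simp only [dsq] at *
  have two : (2 : F) ≠ 0 := two_ne_zero
  have cd : 2 * ((C1 - M1) * (D1 - M1) + (C2 - M2) * (D2 - M2)) = a := by
    linear_combination hCM + hDM - hCD
  have det : (C1 - M1) * (D2 - M2) - (C2 - M2) * (D1 - M1) ≠ 0 := by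
    intro h
    have : 3 * a ^ 2 = 0 := by
      have e : 4 * ((C1 - M1) * (D2 - M2) - (C2 - M2) * (D1 - M1)) ^ 2 = 3 * a ^ 2 := by
        have : 4 * ((C1 - M1) * (D2 - M2) - (C2 - M2) * (D1 - M1)) ^ 2
          = 4 * (((C1 - M1) ^ 2 + (C2 - M2) ^ 2) * ((D1 - M1) ^ 2 + (D2 - M2) ^ 2))
            - (2 * ((C1 - M1) * (D1 - M1) + (C2 - M2) * (D2 - M2))) ^ 2 := by ring
        rw [this, cd, hCM, hDM]; ring
      rw [← e, h]; ring
    simp [ha] at this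
  obtain ⟨u1, u2⟩ := zero_of_perp (v1 := (A1 - M1) - (C1 - M1) + (D1 - M1))
    (v2 := (A2 - M2) - (C2 - M2) + (D2 - M2))
    (by apply mul_left_cancel₀ two; linear_combination hAM - hCM + hDM - hAC - hCD + hCM)
    (by apply mul_left_cancel₀ two; linear_combination hAM + hDM - hAD - hCM + hCD + hDM) det
  obtain ⟨w1, w2⟩ := zero_of_perp (v1 := (B1 - M1) - (D1 - M1) + (C1 - M1))
    (v2 := (B2 - M2) - (D2 - M2) + (C2 - M2))
    (by apply mul_left_cancel₀ two; linear_combination hBM + hCM - hBC - hDM + hCD + hCM)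
    (by apply mul_left_cancel₀ two; linear_combination hBM - hDM + hCM - hBD - hCD + hDM) det
  have e1 : A1 = C1 - D1 + M1 := by linear_combination u1
  have e2 : A2 = C2 - D2 + M2 := by linear_combination u2
  have e3 : B1 = D1 - C1 + M1 := by linear_combination w1
  have e4 : B2 = D2 - C2 + M2 := by linear_combination w2
  rw [e1, e2, e3, e4]; linear_combination 4 * hCD

lemma collinear {A X B : F × F} {r n : F} (hr : r ≠ 0) (h1 : dsq A X = r)
    (h2 : dsq A B = n ^ 2 * r) (h3 : dsq X B = (n - 1) ^ 2 * r) :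
    B.1 - A.1 = n * (X.1 - A.1) ∧ B.2 - A.2 = n * (X.2 - A.2) := by
  obtain ⟨A1, A2⟩ := A
  obtain ⟨B1, B2⟩ := B
  obtain ⟨X1, X2⟩ := X
  simp only [dsq] at *
  have two : (2 : F) ≠ 0 := two_ne_zero
  have i : (B1 - A1) * (X1 - A1) + (B2 - A2) * (X2 - A2) = n * r := by
    apply mul_left_cancel₀ two; linear_combination h1 + h2 - h3
  have p : ((B1 - A1) - n * (X1 - A1)) * (X1 - A1)
      + ((B2 - A2) - n * (X2 - A2)) * (X2 - A2) = 0 := by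
    linear_combination i - n * h1
  have q : (((B2 - A2) - n * (X2 - A2)) * (X1 - A1)
      - ((B1 - A1) - n * (X1 - A1)) * (X2 - A2)) ^ 2 = 0 := by
    have e : ((B1 - A1) - n * (X1 - A1)) ^ 2 + ((B2 - A2) - n * (X2 - A2)) ^ 2 = 0 := by
      linear_combination h2 - 2 * n * i + n ^ 2 * h1
    linear_combination ((X1 - A1) ^ 2 + (X2 - A2) ^ 2) * e - (((B1 - A1) - n * (X1 - A1)) * (X1 - A1)
      + ((B2 - A2) - n * (X2 - A2)) * (X2 - A2)) * p
  have q' := pow_eq_zero_iff (two_ne_zero) |>.1 q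
  obtain ⟨u, v⟩ := zero_of_perp p (d1 := -(X2 - A2)) (d2 := X1 - A1)
    (by linear_combination q') (by intro h; apply hr; linear_combination h - h1)
  exact ⟨sub_eq_zero.1 u, sub_eq_zero.1 v⟩

end algebra

lemma dsq_comm {K : Type*} [Field K] (p q : K × K) : dsq p q = dsq q p := by
  simp only [dsq]; ring

lemma tri (x y : ℝ × ℝ) {r s d : ℝ} (hd : 0 < d) (h : dsq x y = d)
    (hh : (r - s + d) ^ 2 ≤ 4 * r * d) : ∃ z, dsq x z = r ∧ dsq y z = s := by
  obtain ⟨x1, x2⟩ := x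
  obtain ⟨y1, y2⟩ := y
  simp only [dsq] at h
  obtain ⟨α, hα⟩ : ∃ α, α * (2 * d) = r - s + d := ⟨(r - s + d) / (2 * d), by field_simp⟩
  have hb : 0 ≤ r / d - α ^ 2 := by
    rw [sub_nonneg, le_div_iff₀ hd]
    rw [← hα] at hh
    have : (α ^ 2 * d) * (4 * d) ≤ r * (4 * d) := by nlinarith
    exact le_of_mul_le_mul_right this (by positivity)
  have hβ := Real.sq_sqrt hb
  set β := √(r / d - α ^ 2)
  have hβ' : (α ^ 2 + β ^ 2) * d = r := by rw [hβ]; field_simp; ring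
  clear_value β
  refine ⟨(x1 + α * (y1 - x1) - β * (y2 - x2), x2 + α * (y2 - x2) + β * (y1 - x1)), ?_, ?_⟩
  · simp only [dsq]; linear_combination (α ^ 2 + β ^ 2) * h + hβ'
  · simp only [dsq]; linear_combination ((1 - α) ^ 2 + β ^ 2) * h + hβ' - hα

section good
variable {F : Type*} [Field F] [CharZero F]

lemma good_one : Good F 1 := by
  intro x y h
  refine ⟨{x, y}, fun f hf => ?_⟩
  have := hf x (by simp) y (by simp) (by simpa using h)
  simpa using this

lemma good_zero : Good F 0 := by
  intro x y h
  have : x = y := by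
    simp only [dsq] at h
    push_cast at h
    ext <;> nlinarith [sq_nonneg (x.1 - y.1), sq_nonneg (x.2 - y.2)]
  subst this
  simp [dsq]

lemma good_rhombus {a b e : ℚ} (hb : 0 < b) (he : 0 < e) (hab : b < 4 * a)
    (hec : e ≤ 4 * (4 * a - b))
    (ga : Good F a) (gb : Good F b) (ge : Good F e) : Good F (4 * a - b) := by
  have hbF : (b : F) ≠ 0 := by exact_mod_cast hb.ne'
  have key : ∀ x y : ℝ × ℝ, dsq x y = ((4 * a - b : ℚ) : ℝ) →
      ∀ᶠ f in L F, f x = f y ∨ dsq (f x) (f y) = ((4 * a - b : ℚ) : F) := by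
    intro x y h
    have hc : (0 : ℝ) < ((4 * a - b : ℚ) : ℝ) := by exact_mod_cast sub_pos.2 hab
    have hbR : (0 : ℝ) < b := by exact_mod_cast hb
    have ht := Real.sq_sqrt (show 0 ≤ (b : ℝ) / (4 * ((4 * a - b : ℚ) : ℝ)) by positivity)
    set t := √((b : ℝ) / (4 * ((4 * a - b : ℚ) : ℝ)))
    have ht' : t ^ 2 * (4 * ((4 * a - b : ℚ) : ℝ)) = b := by rw [ht]; field_simp
    clear_value t
    push_cast at ht' h
    obtain ⟨x1, x2⟩ := x
    obtain ⟨y1, y2⟩ := y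
    simp only [dsq] at h
    set p : ℝ × ℝ := ((x1 + y1) / 2 - t * (y2 - x2), (x2 + y2) / 2 + t * (y1 - x1)) with hp
    set q : ℝ × ℝ := ((x1 + y1) / 2 + t * (y2 - x2), (x2 + y2) / 2 - t * (y1 - x1)) with hq
    have k0 := gb p q (by simp only [dsq, p, q]; linear_combination 4 * t ^ 2 * h + ht')
    have k1 := ga (x1, x2) p (by
      simp only [dsq, p]; linear_combination (t ^ 2 + 1 / 4) * h + ht' / 4)
    have k2 := ga (x1, x2) q (by
      simp only [dsq, q]; linear_combination (t ^ 2 + 1 / 4) * h + ht' / 4)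
    have k3 := ga (y1, y2) p (by
      simp only [dsq, p]; linear_combination (t ^ 2 + 1 / 4) * h + ht' / 4)
    have k4 := ga (y1, y2) q (by
      simp only [dsq, q]; linear_combination (t ^ 2 + 1 / 4) * h + ht' / 4)
    filter_upwards [k0, k1, k2, k3, k4] with f f0 f1 f2 f3 f4
    have := rhombus hbF f0 f1 f2 f3 f4
    push_cast
    exact this
  by_cases hne : e = 4 * a - b
  · rw [← hne]; exact ge
  intro x y h
  have hc : (0 : ℝ) < ((4 * a - b : ℚ) : ℝ) := by exact_mod_cast sub_pos.2 hab
  have heR : (0 : ℝ) < e := by exact_mod_cast he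
  have hecR : (e : ℝ) ≤ 4 * ((4 * a - b : ℚ) : ℝ) := by exact_mod_cast hec
  obtain ⟨z, hz1, hz2⟩ := tri x y (r := ((4 * a - b : ℚ) : ℝ)) (s := (e : ℝ)) hc h (by nlinarith)
  filter_upwards [key x y h, key x z hz1, ge y z hz2] with f f1 f2 f3
  rcases f1 with f1 | f1
  · exfalso
    rw [← f1] at f3
    rcases f2 with f2 | f2
    · rw [f2] at f3
      simp only [dsq, sub_self] at f3
      have : (e : F) ≠ 0 := by exact_mod_cast he.ne'
      apply this; rw [← f3]; ring
    · rw [f3] at f2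
      exact hne (by exact_mod_cast f2)
  · exact f1

lemma good_three {a : ℚ} (ha : 0 < a) (ga : Good F a) : Good F (3 * a) := by
  have := good_rhombus (a := a) (b := a) (e := a) ha ha (by linarith) (by linarith) ga ga ga
  convert this using 1; ring

lemma good_four {a : ℚ} (ha : 0 < a) (ga : Good F a) : Good F (4 * a) := by
  have g3 := good_three ha ga
  have haF : (a : F) ≠ 0 := by exact_mod_cast ha.ne'
  rintro ⟨x1, x2⟩ ⟨y1, y2⟩ h
  simp only [dsq] at h
  push_cast at h
  have h3 := Real.sq_sqrt (show (0 : ℝ) ≤ 3 by norm_num)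
  set t := √(3 : ℝ)
  clear_value t
  set M : ℝ × ℝ := ((x1 + y1) / 2, (x2 + y2) / 2) with hM
  set C : ℝ × ℝ := (x1 + (y1 - x1) / 4 - t / 4 * (y2 - x2),
    x2 + (y2 - x2) / 4 + t / 4 * (y1 - x1)) with hC
  set D : ℝ × ℝ := (x1 + 3 * (y1 - x1) / 4 - t / 4 * (y2 - x2),
    x2 + 3 * (y2 - x2) / 4 + t / 4 * (y1 - x1)) with hD
  have hAM : dsq (x1, x2) M = (a : ℝ) := by
    simp only [dsq, M]; linear_combination h / 4
  have hBM : dsq (y1, y2) M = (a : ℝ) := by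
    simp only [dsq, M]; linear_combination h / 4
  have hAC : dsq (x1, x2) C = (a : ℝ) := by
    simp only [dsq, C]; linear_combination (1 / 16 + t ^ 2 / 16) * h + a / 4 * h3
  have hCM : dsq C M = (a : ℝ) := by
    simp only [dsq, C, M]; linear_combination (1 / 16 + t ^ 2 / 16) * h + a / 4 * h3
  have hCD : dsq C D = (a : ℝ) := by
    simp only [dsq, C, D]; linear_combination h / 4
  have hDM : dsq D M = (a : ℝ) := by
    simp only [dsq, D, M]; linear_combination (1 / 16 + t ^ 2 / 16) * h + a / 4 * h3
  have hBD : dsq (y1, y2) D = (a : ℝ) := by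
    simp only [dsq, D]; linear_combination (1 / 16 + t ^ 2 / 16) * h + a / 4 * h3
  have hAD : dsq (x1, x2) D = ((3 * a : ℚ) : ℝ) := by
    push_cast
    simp only [dsq, D]; linear_combination (9 / 16 + t ^ 2 / 16) * h + a / 4 * h3
  have hBC : dsq (y1, y2) C = ((3 * a : ℚ) : ℝ) := by
    push_cast
    simp only [dsq, C]; linear_combination (9 / 16 + t ^ 2 / 16) * h + a / 4 * h3
  filter_upwards [ga _ _ hAM, ga _ _ hBM, ga _ _ hAC, ga _ _ hCM, ga _ _ hCD, ga _ _ hDM,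
    ga _ _ hBD, g3 _ _ hAD, g3 _ _ hBC] with f f1 f2 f3 f4 f5 f6 f7 f8 f9
  push_cast at f8 f9 ⊢
  exact lattice haF f1 f2 f3 f4 f5 f6 f7 f8 f9

lemma good_thales {r b n : ℚ} (hr : 0 < r) (hb : 0 < b) (hn : n ≠ 0) (hbr : b ≤ 4 * (n ^ 2 * r))
    (g1 : Good F r) (g2 : Good F (n ^ 2 * r)) (g3 : Good F ((n - 1) ^ 2 * r)) (gb : Good F b) :
    Good F (b / n ^ 2) := by
  intro x y h
  have hrF : (r : F) ≠ 0 := by exact_mod_cast hr.ne'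
  have hnF : (n : F) ≠ 0 := by exact_mod_cast hn
  have hnR : (n : ℝ) ≠ 0 := by exact_mod_cast hn
  have hd : 0 < b / n ^ 2 := by positivity
  have hdr : b / n ^ 2 ≤ 4 * r := by
    rw [div_le_iff₀ (by positivity)]; linarith
  have hdR : (0 : ℝ) < ((b / n ^ 2 : ℚ) : ℝ) := by exact_mod_cast hd
  have hdrR : ((b / n ^ 2 : ℚ) : ℝ) ≤ 4 * r := by exact_mod_cast hdr
  obtain ⟨A, hA1, hA2⟩ := tri x y (r := (r : ℝ)) (s := (r : ℝ)) hdR h (by nlinarith)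
  have hbn : ((b / n ^ 2 : ℚ) : ℝ) * n ^ 2 = b := by push_cast; field_simp
  rw [← h] at hbn
  obtain ⟨x1, x2⟩ := x
  obtain ⟨y1, y2⟩ := y
  obtain ⟨A1, A2⟩ := A
  clear h
  set B : ℝ × ℝ := (A1 + n * (x1 - A1), A2 + n * (x2 - A2)) with hB
  set C : ℝ × ℝ := (A1 + n * (y1 - A1), A2 + n * (y2 - A2)) with hC
  simp only [dsq] at hA1 hA2 hbn
  have k1 := g1 (A1, A2) (x1, x2) (by simp only [dsq]; linear_combination hA1)
  have k2 := g2 (A1, A2) B (by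
    simp only [dsq, B]; push_cast; linear_combination (n : ℝ) ^ 2 * hA1)
  have k3 := g3 (x1, x2) B (by
    simp only [dsq, B]; push_cast; linear_combination ((n : ℝ) - 1) ^ 2 * hA1)
  have k4 := g1 (A1, A2) (y1, y2) (by simp only [dsq]; linear_combination hA2)
  have k5 := g2 (A1, A2) C (by
    simp only [dsq, C]; push_cast; linear_combination (n : ℝ) ^ 2 * hA2)
  have k6 := g3 (y1, y2) C (by
    simp only [dsq, C]; push_cast; linear_combination ((n : ℝ) - 1) ^ 2 * hA2)
  have k7 := gb B C (by simp only [dsq, B, C]; linear_combination hbn)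
  filter_upwards [k1, k2, k3, k4, k5, k6, k7] with f f1 f2 f3 f4 f5 f6 f7
  push_cast at f2 f3 f5 f6
  obtain ⟨u1, u2⟩ := collinear hrF f1 f2 f3
  obtain ⟨v1, v2⟩ := collinear hrF f4 f5 f6
  push_cast
  rw [eq_div_iff (pow_ne_zero 2 hnF), ← f7]
  simp only [dsq]
  have e1 : (f B).1 - (f C).1 = n * ((f (x1, x2)).1 - (f (y1, y2)).1) := by
    linear_combination u1 - v1
  have e2 : (f B).2 - (f C).2 = n * ((f (x1, x2)).2 - (f (y1, y2)).2) := by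
    linear_combination u2 - v2
  rw [e1, e2]; ring

lemma good_quarter {a : ℚ} (ha : 0 < a) (ga : Good F a) : Good F (a / 4) := by
  have h4 := good_four ha ga
  have := good_thales (F := F) (r := a) (b := a) (n := 2) ha ha two_ne_zero (by linarith) ga
    (by convert h4 using 1; norm_num) (by convert ga using 1; norm_num) ga
  convert this using 1; norm_num

lemma good_small (k : ℕ) : Good F ((1 / 4 : ℚ) ^ k) := by
  induction k with
  | zero => simpa using good_one
  | succ k ih =>
    have := good_quarter (by positivity) ih
    convert this using 1; rw [pow_succ]; ring

lemma good_large (k : ℕ) : Good F ((4 : ℚ) ^ k) := by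
  induction k with
  | zero => simpa using good_one
  | succ k ih =>
    have := good_four (by positivity) ih
    convert this using 1; rw [pow_succ]; ring

lemma good_sub {a b : ℚ} (hb : 0 < b) (hab : b < a) (ga : Good F a) (gb : Good F b) :
    Good F (a - b) := by
  obtain ⟨k, hk⟩ := exists_pow_lt_of_lt_one (sub_pos.2 hab) (show (1 / 4 : ℚ) < 1 by norm_num)
  have := good_rhombus (F := F) (a := a / 4) (b := b) (e := (1 / 4 : ℚ) ^ k) hb (by positivity)
    (by linarith) (by linarith) (good_quarter (by linarith) ga) gb (good_small k)
  convert this using 1; ring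

lemma good_add {a b : ℚ} (ha : 0 < a) (hb : 0 < b) (ga : Good F a) (gb : Good F b) :
    Good F (a + b) := by
  obtain ⟨k, hk⟩ := pow_unbounded_of_one_lt (a + b) (show (1 : ℚ) < 4 by norm_num)
  have h1 := good_sub ha (by linarith) (good_large (F := F) k) ga
  have h2 := good_sub hb (by linarith) h1 gb
  have h3 := good_sub (by linarith) (by linarith) (good_large (F := F) k) h2
  convert h3 using 1; ring

lemma good_nat (n : ℕ) : Good F (n : ℚ) := by
  induction n with
  | zero => simpa using good_zero
  | succ n ih =>
    rcases Nat.eq_zero_or_pos n with rfl | h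
    · simpa using good_one
    · push_cast
      exact good_add (by exact_mod_cast h) one_pos ih good_one

lemma good_all {q : ℚ} (hq : 0 ≤ q) : Good F q := by
  rcases hq.eq_or_lt with rfl | hq
  · exact good_zero
  obtain ⟨p, n, hn, hp, rfl⟩ : ∃ p n : ℕ, 0 < n ∧ 0 < p ∧ q = (p * n : ℕ) / (n : ℚ) ^ 2 := by
    refine ⟨q.num.toNat, q.den, q.den_pos, by have := Rat.num_pos.2 hq; omega, ?_⟩
    have h1 : ((q.num.toNat : ℕ) : ℚ) = q.num := by
      exact_mod_cast Int.toNat_of_nonneg (Rat.num_pos.2 hq).le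
    have h2 : (q.den : ℚ) ≠ 0 := by exact_mod_cast q.den_pos.ne'
    push_cast
    rw [h1, pow_two, mul_div_mul_right _ _ h2, Rat.num_div_den]
  obtain ⟨m, rfl⟩ : ∃ m, n = m + 1 := ⟨n - 1, by omega⟩
  have hp' : (1 : ℚ) ≤ p := by exact_mod_cast hp
  have hm : (0 : ℚ) ≤ m := by positivity
  refine good_thales (r := (p : ℚ)) (by linarith) (by positivity) (by positivity) ?_
    (good_nat p) ?_ ?_ (good_nat _)
  · push_cast
    nlinarith [mul_nonneg hm hm, mul_nonneg (by linarith : (0 : ℚ) ≤ p) hm,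
      mul_nonneg (by linarith : (0 : ℚ) ≤ p) (mul_nonneg hm hm)]
  · have := good_nat (F := F) ((m + 1) ^ 2 * p)
    convert this using 1; push_cast; ring
  · have := good_nat (F := F) (m ^ 2 * p)
    convert this using 1; push_cast; ring

end good

end BQ

/-- **Theorem 3.** If `x, y ∈ ℝ²` and `|x - y|²` is a rational number `q`,
then there is a finite set `S ⊆ ℝ²` containing `x` and `y` such that every
unit-distance preserving map `f : S → F²` satisfies
`φ₂(f x, f y) = |x - y|²` (i.e. `= q`, cast into `F`). -/
theorem stmt_2 (F : Type*) [Field F] [CharZero F]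
    (x y : EuclideanSpace ℝ (Fin 2)) (q : ℚ) (hq : dist x y ^ 2 = (q : ℝ)) :
    ∃ S : Finset (EuclideanSpace ℝ (Fin 2)), ∃ hx : x ∈ S, ∃ hy : y ∈ S,
      ∀ f : S → (Fin 2 → F),
        (∀ u v : S,
          dist (u : EuclideanSpace ℝ (Fin 2)) (v : EuclideanSpace ℝ (Fin 2)) = 1 →
          ∑ i, (f u i - f v i) ^ 2 = 1) →
        ∑ i, (f ⟨x, hx⟩ i - f ⟨y, hy⟩ i) ^ 2 = (q : F) := by
  classical
  have hds : ∀ u v : EuclideanSpace ℝ (Fin 2),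
      dist u v ^ 2 = BQ.dsq (u 0, u 1) (v 0, v 1) := by
    intro u v
    rw [EuclideanSpace.dist_sq_eq, Fin.sum_univ_two]
    simp [BQ.dsq, Real.dist_eq, sq_abs]
  have hq0 : 0 ≤ q := by
    have : (0 : ℝ) ≤ q := by rw [← hq]; positivity
    exact_mod_cast this
  obtain ⟨S, hS⟩ := BQ.good_all (F := F) hq0 (x 0, x 1) (y 0, y 1) (by rw [← hds, hq])
  let e : ℝ × ℝ → EuclideanSpace ℝ (Fin 2) := fun p => !₂[p.1, p.2]
  have he : ∀ u : EuclideanSpace ℝ (Fin 2), e (u 0, u 1) = u := by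
    intro u
    ext i
    fin_cases i <;> simp [e]
  refine ⟨insert x (insert y (S.image e)), by simp, by simp, fun f hf => ?_⟩
  let g : ℝ × ℝ → F × F := fun p =>
    if h : e p ∈ insert x (insert y (S.image e)) then (f ⟨e p, h⟩ 0, f ⟨e p, h⟩ 1) else 0
  have hg := hS g (by
    intro u hu v hv huv
    have hu' : e u ∈ insert x (insert y (S.image e)) := by
      simp only [Finset.mem_insert]; exact Or.inr (Or.inr (Finset.mem_image_of_mem e hu))
    have hv' : e v ∈ insert x (insert y (S.image e)) := by
      simp only [Finset.mem_insert]; exact Or.inr (Or.inr (Finset.mem_image_of_mem e hv))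
    have h1 : dist (e u) (e v) = 1 := by
      have h2 : dist (e u) (e v) ^ 2 = 1 := by rw [hds]; simpa [e] using huv
      exact (pow_eq_one_iff_of_nonneg dist_nonneg two_ne_zero).1 h2
    have := hf ⟨e u, hu'⟩ ⟨e v, hv'⟩ h1
    rw [Fin.sum_univ_two] at this
    simp only [g, dif_pos hu', dif_pos hv', BQ.dsq]
    exact this)
  have hx : ∀ u (hu : u ∈ insert x (insert y (S.image e))),
      g (u 0, u 1) = (f ⟨u, hu⟩ 0, f ⟨u, hu⟩ 1) := by
    intro u hu
    simp only [g, he, dif_pos hu]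
  rw [Fin.sum_univ_two]
  simp only [Set.mem_ofPred_eq] at hg
  rw [hx x (by simp), hx y (by simp)] at hg
  exact hg
end

section
/- Let n ≥ 1. If x,y ∈ ℝⁿ and |x−y|² is not a rational number, then there exists a map f : ℝⁿ → ℂⁿ such that φ_n(f(x),f(y)) ≠ |x−y|², yet for every rational r ≥ 0 and all u,v ∈ ℝⁿ with |u−v| = √r one has φ_n(f(u),f(v)) = r (Theorem 1). -/
open Cardinal Polynomial in
theorem aux_ext {R : Type} {K L : Type} [CommRing R] [Nontrivial R] [Field K] [Field L]
    [IsAlgClosed K] [IsAlgClosed L] [Algebra R K] [Algebra R L]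
    [FaithfulSMul R K] [FaithfulSMul R L] (hR : #R ≤ ℵ₀)
    (hK : ℵ₀ < #K) (hKL : #K = #L) :
    ∃ e : K ≃+* L, ∀ r : R, e (algebraMap R K r) = algebraMap R L r := by
  obtain ⟨s, hs⟩ := exists_isTranscendenceBasis R K
  obtain ⟨t, ht⟩ := exists_isTranscendenceBasis R L
  have h1 := IsAlgClosed.cardinal_eq_cardinal_transcendence_basis_of_aleph0_lt' _ hs hR hK
  have h2 := IsAlgClosed.cardinal_eq_cardinal_transcendence_basis_of_aleph0_lt' _ ht hR
    (hKL ▸ hK)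
  obtain ⟨e⟩ := Cardinal.eq.1 (h1.symm.trans (hKL.trans h2))
  let := IsAlgClosed.isAlgClosure_of_transcendence_basis _ hs
  let := IsAlgClosed.isAlgClosure_of_transcendence_basis _ ht
  let E := (hs.1.aevalEquiv.symm.trans (MvPolynomial.renameEquiv R e)).trans ht.1.aevalEquiv
  refine ⟨IsAlgClosure.equivOfEquiv K L E.toRingEquiv, fun r => ?_⟩
  have := IsAlgClosure.equivOfEquiv_algebraMap K L E.toRingEquiv (algebraMap R _ r)
  have h3 : E.toRingEquiv (algebraMap R _ r) = algebraMap R _ r := E.commutes r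
  rw [h3] at this
  exact this

open Cardinal Polynomial in
theorem aux_ext2 {R : Type} [CommRing R] [Nontrivial R] [Countable R] (i j : R →+* ℂ)
    (hi : Function.Injective i) (hj : Function.Injective j) :
    ∃ e : ℂ ≃+* ℂ, ∀ r : R, e (i r) = j r := by
  have hR : #R ≤ ℵ₀ := Cardinal.mk_le_aleph0
  have hK : ℵ₀ < #ℂ := by rw [Cardinal.mk_complex]; exact Cardinal.aleph0_lt_continuum
  exact @aux_ext R ℂ ℂ _ _ _ _ _ _ i.toAlgebra j.toAlgebra
    ((@faithfulSMul_iff_algebraMap_injective R ℂ _ _ i.toAlgebra).2 hi)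
    ((@faithfulSMul_iff_algebraMap_injective R ℂ _ _ j.toAlgebra).2 hj) hR hK rfl

open Cardinal Polynomial in
theorem aux_move (d : ℂ) (hd : ¬ ∃ q : ℚ, (q : ℂ) = d) : ∃ e : ℂ ≃+* ℂ, e d ≠ d := by
  have : Countable ℚ[X] := by
    rw [← Cardinal.mk_le_aleph0_iff]
    exact Polynomial.cardinalMk_le_max.trans (by simp)
  by_cases ha : IsAlgebraic ℚ d
  · have hint := ha.isIntegral
    have hirr := minpoly.irreducible hint
    have h2 : d ∉ (⊥ : Subalgebra ℚ ℂ) := by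
      rintro ⟨q, hq⟩
      exact hd ⟨q, by simpa using hq⟩
    rw [notMem_iff_exists_ne_and_isConjRoot hirr.separable (IsAlgClosed.splits _)] at h2
    obtain ⟨d', hne, hc⟩ := h2
    have := Fact.mk hirr
    have : Countable (AdjoinRoot (minpoly ℚ d)) :=
      (AdjoinRoot.mk_surjective (g := minpoly ℚ d)).countable
    obtain ⟨e, he⟩ := aux_ext2
      (AdjoinRoot.lift (algebraMap ℚ ℂ) d (minpoly.aeval ℚ d))
      (AdjoinRoot.lift (algebraMap ℚ ℂ) d' hc.aeval_eq_zero)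
      (RingHom.injective _) (RingHom.injective _)
    refine ⟨e, ?_⟩
    have := he (AdjoinRoot.root _)
    have h1 : AdjoinRoot.lift (algebraMap ℚ ℂ) d (minpoly.aeval ℚ d)
        (AdjoinRoot.root (minpoly ℚ d)) = d := AdjoinRoot.lift_root _
    have h2 : AdjoinRoot.lift (algebraMap ℚ ℂ) d' hc.aeval_eq_zero
        (AdjoinRoot.root (minpoly ℚ d)) = d' := AdjoinRoot.lift_root _
    have h3 : e d = d' := (congrArg e h1).symm.trans (this.trans h2)
    rw [h3]
    exact hne.symm
  · have hT : Transcendental ℚ d := ha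
    have hT' : Transcendental ℚ (d + 1) := by
      intro h
      apply hT
      simpa using h.sub (isAlgebraic_one (R := ℚ) (A := ℂ))
    obtain ⟨e, he⟩ := aux_ext2 (aeval (R := ℚ) d).toRingHom (aeval (R := ℚ) (d + 1)).toRingHom
      (transcendental_iff_injective.1 hT) (transcendental_iff_injective.1 hT')
    refine ⟨e, ?_⟩
    have := he X
    simp at this
    simp [this]

/-- **Theorem 1.** If `x, y ∈ ℝⁿ` and `|x - y|²` is not rational, then there
exists `f : ℝⁿ → ℂⁿ` that does not preserve the distance between `x` and `y`
(i.e. `φₙ(f x, f y) ≠ |x - y|²`) although `f` preserves all distances `√r`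
with rational `r ≥ 0`. -/
theorem stmt_4 (n : ℕ) (hn : 1 ≤ n) (x y : EuclideanSpace ℝ (Fin n))
    (h : ¬ ∃ q : ℚ, (q : ℝ) = dist x y ^ 2) :
    ∃ f : EuclideanSpace ℝ (Fin n) → (Fin n → ℂ),
      (∑ i, (f x i - f y i) ^ 2 ≠ ((dist x y ^ 2 : ℝ) : ℂ)) ∧
      (∀ q : ℚ, 0 ≤ q → ∀ u v : EuclideanSpace ℝ (Fin n),
        dist u v = Real.sqrt q → ∑ i, (f u i - f v i) ^ 2 = (q : ℂ)) := by
  obtain ⟨e, he⟩ := aux_move ((dist x y ^ 2 : ℝ) : ℂ) (by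
    rintro ⟨q, hq⟩
    exact h ⟨q, by exact_mod_cast hq⟩)
  have key : ∀ u v : EuclideanSpace ℝ (Fin n),
      ∑ i, (e (u i : ℂ) - e (v i : ℂ)) ^ 2 = e ((dist u v ^ 2 : ℝ) : ℂ) := by
    intro u v
    rw [EuclideanSpace.dist_eq, Real.sq_sqrt (Finset.sum_nonneg fun i _ => sq_nonneg _)]
    simp only [Real.dist_eq, sq_abs]
    push_cast
    simp [map_sum]
  refine ⟨fun u i => e (u i : ℂ), ?_, ?_⟩
  · rw [key]; exact he
  · intro q hq u v huv
    rw [key, huv, Real.sq_sqrt (by exact_mod_cast hq)]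
    simp
end

section
/- If r is a complex number that is not rational (i.e., r is not the image of any rational number in ℂ), then there exists a field automorphism g : ℂ → ℂ such that g(r) ≠ r (Proposition 1). -/
open MvPolynomial in
theorem extend_aux {R ι : Type} [CommRing R] [Algebra R ℂ] (v : ι → ℂ)
    (hv : IsTranscendenceBasis R v) (φ : MvPolynomial ι R ≃+* MvPolynomial ι R) :
    ∃ g : ℂ ≃+* ℂ, ∀ p, g (aeval v p) = aeval v (φ p) := by
  let := IsAlgClosed.isAlgClosure_of_transcendence_basis v hv
  have := RingHom.domain_nontrivial (algebraMap R ℂ)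
  let e : Algebra.adjoin R (Set.range v) ≃+* Algebra.adjoin R (Set.range v) :=
    (hv.1.aevalEquiv.symm.toRingEquiv.trans φ).trans hv.1.aevalEquiv.toRingEquiv
  refine ⟨IsAlgClosure.equivOfEquiv ℂ ℂ e, fun p => ?_⟩
  have h := IsAlgClosure.equivOfEquiv_algebraMap ℂ ℂ e (hv.1.aevalEquiv p)
  have h2 : e (hv.1.aevalEquiv p) = hv.1.aevalEquiv (φ p) := by simp [e]
  rw [h2] at h
  simpa using h

open MvPolynomial in
/-- **Proposition 1.** If `r ∈ ℂ` is not a rational number, then there exists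
a field automorphism `g : ℂ → ℂ` such that `g r ≠ r`. -/
theorem stmt_5 (r : ℂ) (hr : ¬ ∃ q : ℚ, (q : ℂ) = r) :
    ∃ g : ℂ ≃+* ℂ, g r ≠ r := by
  by_cases halg : IsAlgebraic ℚ r
  · let K := algebraicClosure ℚ ℂ
    let r' : K := ⟨r, mem_algebraicClosure_iff.2 halg⟩
    have : IsAlgClosure ℚ K := algebraicClosure.isAlgClosure ℚ ℂ
    have : Normal ℚ K := IsAlgClosure.normal ℚ K
    have : IsGalois ℚ K := ⟨⟩
    have h1 : ¬ ∀ σ : K ≃ₐ[ℚ] K, σ r' = r' := by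
      intro h
      obtain ⟨q, hq⟩ := (InfiniteGalois.mem_range_algebraMap_iff_fixed (k := ℚ) r').2 h
      exact hr ⟨q, by simpa [r'] using congrArg (algebraMap K ℂ) hq⟩
    push Not at h1
    obtain ⟨σ, hσ⟩ := h1
    obtain ⟨s, hs⟩ := exists_isTranscendenceBasis K ℂ
    obtain ⟨g, hg⟩ := extend_aux _ hs (mapEquiv s σ.toRingEquiv)
    refine ⟨g, fun h => hσ ?_⟩
    have h3 := hg (C r')
    simp only [mapEquiv_apply, map_C, aeval_C] at h3
    apply (algebraMap K ℂ).injective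
    exact h3.symm.trans h
  · obtain ⟨s, hrs, hs⟩ := exists_isTranscendenceBasis_superset (R := ℚ) (s := {r})
      ((algebraicIndependent_singleton_iff (⟨r, rfl⟩ : ({r} : Set ℂ))).2 halg)
    let f : MvPolynomial s ℚ →ₐ[ℚ] MvPolynomial s ℚ := aeval (fun i => -X i)
    have hf : f.comp f = AlgHom.id _ _ := by ext; simp [f]
    obtain ⟨g, hg⟩ := extend_aux _ hs (AlgEquiv.ofAlgHom f f hf hf).toRingEquiv
    refine ⟨g, fun h => hr ⟨0, ?_⟩⟩
    have h3 := hg (X ⟨r, hrs rfl⟩)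
    simp [f, h] at h3
    simpa using (self_eq_neg.1 h3).symm
end

section
/- Let F be a field of characteristic 0, n ≥ 1, and d ∈ F with d ≠ 0. If c₁,…,c_{n+1} ∈ Fⁿ satisfy φ_n(c_i,c_j) = d² for all 1 ≤ i < j ≤ n+1, then the points c₁,…,c_{n+1} are affinely independent (Proposition 4a). -/
/-- **Proposition 4a.** If `d ∈ F`, `d ≠ 0`, and the points
`c₁, …, c_{n+1} ∈ Fⁿ` satisfy `φₙ(cᵢ, cⱼ) = d²` for all `i < j`, then the
points `c₁, …, c_{n+1}` are affinely independent. -/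
theorem stmt_7 (F : Type*) [Field F] [CharZero F] (n : ℕ) (hn : 1 ≤ n)
    (d : F) (hd : d ≠ 0) (c : Fin (n + 1) → (Fin n → F))
    (h : ∀ i j : Fin (n + 1), i < j → ∑ k, (c i k - c j k) ^ 2 = d ^ 2) :
    AffineIndependent F c := by
  rw [affineIndependent_iff]
  intro s w hw hc
  have hQ : ∀ i j, ∑ k, (c i k - c j k) ^ 2 = d ^ 2 - if j = i then d ^ 2 else 0 := by
    intro i j
    rcases lt_trichotomy i j with hij | hij | hij
    · rw [h i j hij, if_neg hij.ne', sub_zero]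
    · subst hij; simp
    · rw [if_neg hij.ne, sub_zero, ← h j i hij]
      exact Finset.sum_congr rfl fun k _ => by ring
  have hck : ∀ k, ∑ e ∈ s, w e * c e k = 0 := by
    intro k
    have := congrFun hc k
    simpa [Finset.sum_apply] using this
  have h1 : ∀ i ∈ s, ∑ e ∈ s, w e * ∑ k, (c i k - c e k) ^ 2 = - (w i * d ^ 2) := by
    intro i hi
    simp only [hQ, mul_sub, Finset.sum_sub_distrib, ← Finset.sum_mul, hw]
    simp [hi]
  have h2 : ∀ i, ∑ e ∈ s, w e * ∑ k, (c i k - c e k) ^ 2 = ∑ k, ∑ e ∈ s, w e * c e k ^ 2 := by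
    intro i
    simp only [Finset.mul_sum]
    rw [Finset.sum_comm]
    refine Finset.sum_congr rfl fun k _ => ?_
    have : ∀ e, w e * (c i k - c e k) ^ 2
        = w e * c i k ^ 2 - (w e * c e k) * (2 * c i k) + w e * c e k ^ 2 := fun e => by ring
    simp only [this, Finset.sum_add_distrib, Finset.sum_sub_distrib, ← Finset.sum_mul, hw, hck]
    ring
  intro i hi
  have hconst : ∀ j ∈ s, w j = w i := by
    intro j hj
    have : w j * d ^ 2 = w i * d ^ 2 := by
      rw [← neg_inj, ← h1 j hj, ← h1 i hi, h2, h2]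
    exact mul_right_cancel₀ (pow_ne_zero 2 hd) this
  rw [Finset.sum_congr rfl hconst, Finset.sum_const, nsmul_eq_mul] at hw
  rcases mul_eq_zero.mp hw with h0 | h0
  · rw [Nat.cast_eq_zero, Finset.card_eq_zero] at h0
    simp [h0] at hi
  · exact h0
end

section
/- Let F be a field of characteristic 0 and a,b ∈ F with a + b ≠ 0. If z, x, x̃ ∈ F² satisfy φ₂(z,x) = a², φ₂(x,x̃) = b² and φ₂(z,x̃) = (a+b)², then x − z = (a/(a+b)) · (x̃ − z) (Proposition 4b). -/
/-- **Proposition 4b.** If `a, b ∈ F`, `a + b ≠ 0`, and `z, x, x̃ ∈ F²`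
satisfy `φ₂(z, x) = a²`, `φ₂(x, x̃) = b²`, `φ₂(z, x̃) = (a + b)²`, then
`x - z = (a / (a + b)) • (x̃ - z)`. -/
theorem stmt_8 (F : Type*) [Field F] [CharZero F] (a b : F) (hab : a + b ≠ 0)
    (z x xt : Fin 2 → F)
    (h1 : ∑ i, (z i - x i) ^ 2 = a ^ 2)
    (h2 : ∑ i, (x i - xt i) ^ 2 = b ^ 2)
    (h3 : ∑ i, (z i - xt i) ^ 2 = (a + b) ^ 2) :
    x - z = (a / (a + b)) • (xt - z) := by
  simp only [Fin.sum_univ_two] at h1 h2 h3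
  obtain ⟨u0, hu0⟩ : ∃ u, u = x 0 - z 0 := ⟨_, rfl⟩
  obtain ⟨u1, hu1⟩ : ∃ u, u = x 1 - z 1 := ⟨_, rfl⟩
  obtain ⟨w0, hw0⟩ : ∃ u, u = xt 0 - z 0 := ⟨_, rfl⟩
  obtain ⟨w1, hw1⟩ : ∃ u, u = xt 1 - z 1 := ⟨_, rfl⟩
  have k1 : u0 ^ 2 + u1 ^ 2 = a ^ 2 := by rw [hu0, hu1, ← h1]; ring
  have k3 : w0 ^ 2 + w1 ^ 2 = (a + b) ^ 2 := by rw [hw0, hw1, ← h3]; ring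
  have k2 : (u0 - w0) ^ 2 + (u1 - w1) ^ 2 = b ^ 2 := by
    rw [hu0, hu1, hw0, hw1, ← h2]; ring
  have two : (2 : F) ≠ 0 := two_ne_zero
  have k4 : u0 * w0 + u1 * w1 = a * (a + b) := by
    apply mul_left_cancel₀ two
    linear_combination k1 + k3 - k2
  have hd : u0 * w1 - u1 * w0 = 0 := by
    apply pow_eq_zero_iff two_ne_zero |>.1
    linear_combination (w0 ^ 2 + w1 ^ 2) * k1 + a ^ 2 * k3
      - (u0 * w0 + u1 * w1 + a * (a + b)) * k4
  have e0 : u0 * (a + b) = a * w0 := by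
    apply mul_left_cancel₀ hab
    linear_combination -u0 * k3 + w0 * k4 + w1 * hd
  have e1 : u1 * (a + b) = a * w1 := by
    apply mul_left_cancel₀ hab
    linear_combination -u1 * k3 + w1 * k4 - w0 * hd
  ext i
  fin_cases i
  · simp only [Pi.sub_apply, Pi.smul_apply, smul_eq_mul, Fin.zero_eta]
    rw [← hu0, ← hw0, div_mul_eq_mul_div, eq_div_iff hab, e0]
  · simp only [Pi.sub_apply, Pi.smul_apply, smul_eq_mul, Fin.mk_one]
    rw [← hu1, ← hw1, div_mul_eq_mul_div, eq_div_iff hab, e1]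
end

section
/- Let F be a field of characteristic 0. If x, y, c₀, c₁, c₂ ∈ F² satisfy φ₂(x,c₀) = φ₂(y,c₀), φ₂(x,c₁) = φ₂(y,c₁), φ₂(x,c₂) = φ₂(y,c₂), and the points c₀, c₁, c₂ are affinely independent, then x = y (Proposition 5). -/
/-- **Proposition 5.** If `x, y, c₀, c₁, c₂ ∈ F²` satisfy
`φ₂(x, cᵢ) = φ₂(y, cᵢ)` for `i = 0, 1, 2` and `c₀, c₁, c₂` are affinely
independent, then `x = y`. -/
theorem stmt_9 (F : Type*) [Field F] [CharZero F]
    (x y c₀ c₁ c₂ : Fin 2 → F)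
    (h0 : ∑ i, (x i - c₀ i) ^ 2 = ∑ i, (y i - c₀ i) ^ 2)
    (h1 : ∑ i, (x i - c₁ i) ^ 2 = ∑ i, (y i - c₁ i) ^ 2)
    (h2 : ∑ i, (x i - c₂ i) ^ 2 = ∑ i, (y i - c₂ i) ^ 2)
    (hind : AffineIndependent F ![c₀, c₁, c₂]) :
    x = y := by
  rw [affineIndependent_iff] at hind
  have key : ∀ u v w : F, u + v + w = 0 → u * c₀ 0 + v * c₁ 0 + w * c₂ 0 = 0 →
      u * c₀ 1 + v * c₁ 1 + w * c₂ 1 = 0 → v = 0 := by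
    intro u v w hs e0 e1
    have := hind Finset.univ ![u, v, w] (by simpa [Fin.sum_univ_three] using hs)
      (by
        ext i
        fin_cases i
        · simpa [Fin.sum_univ_three] using e0
        · simpa [Fin.sum_univ_three] using e1) 1 (Finset.mem_univ _)
    simpa using this
  simp only [Fin.sum_univ_two] at h0 h1 h2
  have two : (2 : F) ≠ 0 := two_ne_zero
  have ea : (c₁ 0 - c₀ 0) * (x 0 - y 0) + (c₁ 1 - c₀ 1) * (x 1 - y 1) = 0 := by
    apply mul_left_cancel₀ two
    linear_combination h0 - h1
  have eb : (c₂ 0 - c₀ 0) * (x 0 - y 0) + (c₂ 1 - c₀ 1) * (x 1 - y 1) = 0 := by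
    apply mul_left_cancel₀ two
    linear_combination h0 - h2
  have hdet : (c₁ 0 - c₀ 0) * (c₂ 1 - c₀ 1) - (c₁ 1 - c₀ 1) * (c₂ 0 - c₀ 0) ≠ 0 := by
    intro hd
    have b0 := key ((c₁ 0 - c₀ 0) - (c₂ 0 - c₀ 0)) (c₂ 0 - c₀ 0) (-(c₁ 0 - c₀ 0))
      (by ring) (by ring) (by linear_combination -hd)
    have b1 := key ((c₁ 1 - c₀ 1) - (c₂ 1 - c₀ 1)) (c₂ 1 - c₀ 1) (-(c₁ 1 - c₀ 1))
      (by ring) (by linear_combination hd) (by ring)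
    have hc : c₂ = c₀ := by
      ext i
      fin_cases i
      · exact sub_eq_zero.mp b0
      · exact sub_eq_zero.mp b1
    have := hind Finset.univ ![1, 0, -1] (by simp [Fin.sum_univ_three])
      (by simp [Fin.sum_univ_three, hc]) 0 (Finset.mem_univ _)
    simp at this
  ext i
  fin_cases i
  · apply sub_eq_zero.mp
    apply (mul_eq_zero.mp _).resolve_left hdet
    simp only [Fin.zero_eta]
    linear_combination (c₂ 1 - c₀ 1) * ea - (c₁ 1 - c₀ 1) * eb
  · apply sub_eq_zero.mp
    apply (mul_eq_zero.mp _).resolve_left hdet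
    simp only [Fin.mk_one]
    linear_combination (c₁ 0 - c₀ 0) * eb - (c₂ 0 - c₀ 0) * ea
end

section
/- Let F be a field of characteristic 0. If E, F', C, D ∈ F² satisfy φ₂(E,F') ≠ 0, C ≠ D and φ₂(E,C) = φ₂(F',C) = φ₂(E,D) = φ₂(F',D), then C − E = F' − D and C − F' = E − D (Proposition 6). -/
/-- In the plane, if `x`, `y` are orthogonal to an anisotropic `u` and to each other, and `x ≠ 0`,
then `y = 0`. -/
lemma orth_aux {F : Type*} [Field F] (p q x0 x1 y0 y1 : F) (hQ : p ^ 2 + q ^ 2 ≠ 0)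
    (hx : x0 * p + x1 * q = 0) (hy : y0 * p + y1 * q = 0) (hxy : x0 * y0 + x1 * y1 = 0)
    (hne : ¬ (x0 = 0 ∧ x1 = 0)) : y0 = 0 ∧ y1 = 0 := by
  have hSR : (p * x1 - q * x0) * (p * y1 - q * y0) = 0 := by
    linear_combination (p ^ 2 + q ^ 2) * hxy - (y0 * p + y1 * q) * hx
  rcases mul_eq_zero.mp hSR with hS | hR
  · exfalso
    apply hne
    constructor
    · apply (mul_eq_zero.mp _).resolve_left hQ
      linear_combination p * hx - q * hS
    · apply (mul_eq_zero.mp _).resolve_left hQ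
      linear_combination q * hx + p * hS
  · constructor
    · apply (mul_eq_zero.mp _).resolve_left hQ
      linear_combination p * hy - q * hR
    · apply (mul_eq_zero.mp _).resolve_left hQ
      linear_combination q * hy + p * hR

/-- **Proposition 6.** If `E, F', C, D ∈ F²`, `φ₂(E, F') ≠ 0`, `C ≠ D` and
`φ₂(E, C) = φ₂(F', C) = φ₂(E, D) = φ₂(F', D)`, then `C - E = F' - D` and
`C - F' = E - D`. -/
theorem stmt_10 (F : Type*) [Field F] [CharZero F] (E F' C D : Fin 2 → F)
    (hEF : ∑ i, (E i - F' i) ^ 2 ≠ 0) (hCD : C ≠ D)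
    (h1 : ∑ i, (E i - C i) ^ 2 = ∑ i, (F' i - C i) ^ 2)
    (h2 : ∑ i, (F' i - C i) ^ 2 = ∑ i, (E i - D i) ^ 2)
    (h3 : ∑ i, (E i - D i) ^ 2 = ∑ i, (F' i - D i) ^ 2) :
    C - E = F' - D ∧ C - F' = E - D := by
  simp only [Fin.sum_univ_two] at hEF h1 h2 h3
  have h2ne : (2 : F) ≠ 0 := two_ne_zero
  have key := orth_aux (E 0 - F' 0) (E 1 - F' 1) (C 0 - D 0) (C 1 - D 1)
    (C 0 + D 0 - E 0 - F' 0) (C 1 + D 1 - E 1 - F' 1) hEF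
    (by
      apply (mul_eq_zero.mp _).resolve_left h2ne
      linear_combination h3 - h1)
    (by linear_combination -(h1 + h3) / 2)
    (by
      apply (mul_eq_zero.mp _).resolve_left h2ne
      linear_combination h1 + 2 * h2 + h3)
    (by
      rintro ⟨h0, h1'⟩
      apply hCD
      funext i
      fin_cases i
      · exact sub_eq_zero.mp h0
      · exact sub_eq_zero.mp h1')
  obtain ⟨k0, k1⟩ := key
  have k : ∀ i, C i + D i - E i - F' i = 0 := Fin.forall_fin_two.mpr ⟨k0, k1⟩
  constructor
  · funext i
    simp only [Pi.sub_apply]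
    linear_combination k i
  · funext i
    simp only [Pi.sub_apply]
    linear_combination k i
end

section
/- Let F be a field of characteristic 0 and d > 0 a real number in D₂(F). Then √3 · d ∈ D₂(F) (Lemma 1). -/
/-- `d ∈ D₂(F)`: `d` is a positive real such that for all `x, y ∈ ℝ²` with
`|x - y| = d` there is a finite set `S` with `{x, y} ⊆ S ⊆ ℝ²` such that every
unit-distance preserving map `f : S → F²` satisfies `φ₂(f x, f y) = d²`
(the value `d²` being interpreted in `F` via its rational value `q`). -/
def MemD2 (F : Type*) [Field F] (d : ℝ) : Prop :=
  0 < d ∧ ∃ q : ℚ, (q : ℝ) = d ^ 2 ∧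
    ∀ x y : EuclideanSpace ℝ (Fin 2), dist x y = d →
      ∃ S : Finset (EuclideanSpace ℝ (Fin 2)), ∃ hx : x ∈ S, ∃ hy : y ∈ S,
        ∀ f : S → (Fin 2 → F),
          (∀ u v : S,
            dist (u : EuclideanSpace ℝ (Fin 2)) (v : EuclideanSpace ℝ (Fin 2)) = 1 →
            ∑ i, (f u i - f v i) ^ 2 = 1) →
          ∑ i, (f ⟨x, hx⟩ i - f ⟨y, hy⟩ i) ^ 2 = (q : F)

lemma forced_total {F : Type*} [Field F] {d : ℝ} {q : ℚ}
    (h : ∀ x y : EuclideanSpace ℝ (Fin 2), dist x y = d →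
      ∃ S : Finset (EuclideanSpace ℝ (Fin 2)), ∃ hx : x ∈ S, ∃ hy : y ∈ S,
        ∀ f : S → (Fin 2 → F),
          (∀ u v : S,
            dist (u : EuclideanSpace ℝ (Fin 2)) (v : EuclideanSpace ℝ (Fin 2)) = 1 →
            ∑ i, (f u i - f v i) ^ 2 = 1) →
          ∑ i, (f ⟨x, hx⟩ i - f ⟨y, hy⟩ i) ^ 2 = (q : F))
    (x y : EuclideanSpace ℝ (Fin 2)) (hxy : dist x y = d) :
    ∃ S : Finset (EuclideanSpace ℝ (Fin 2)), 
        ∀ f : EuclideanSpace ℝ (Fin 2) → (Fin 2 → F),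
          (∀ u ∈ S, ∀ v ∈ S, dist u v = 1 → ∑ i, (f u i - f v i) ^ 2 = 1) →
          (f x 0 - f y 0) ^ 2 + (f x 1 - f y 1) ^ 2 = (q : F) := by
  obtain ⟨S, hx, hy, H⟩ := h x y hxy
  refine ⟨S, fun f hf => ?_⟩
  have := H (fun u => f u) (fun u v huv => hf u u.2 v v.2 huv)
  simpa [Fin.sum_univ_two] using this

lemma dist_two {x y : EuclideanSpace ℝ (Fin 2)} {d : ℝ} (hd : 0 < d) :
    dist x y = d ↔ (x 0 - y 0) ^ 2 + (x 1 - y 1) ^ 2 = d ^ 2 := by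
  rw [EuclideanSpace.dist_eq, Real.sqrt_eq_iff_eq_sq (by positivity) hd.le]
  simp [Fin.sum_univ_two, Real.dist_eq, sq_abs]

/-- the algebra of a rhombus, with one vertex at the origin. -/
lemma rhombus_alg {F : Type*} [Field F] [CharZero F] {q u v p r s t : F} (hq : q ≠ 0)
    (h1 : u ^ 2 + v ^ 2 = q) (h2 : p ^ 2 + r ^ 2 = q) (h3 : s ^ 2 + t ^ 2 = q)
    (h4 : (p - u) ^ 2 + (r - v) ^ 2 = q) (h5 : (s - u) ^ 2 + (t - v) ^ 2 = q) :
    (p = s ∧ r = t) ∨ (p - s) ^ 2 + (r - t) ^ 2 = 3 * q := by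
  have e1 : 2 * (p * u + r * v) = q := by linear_combination h2 + h1 - h4
  have e2 : 2 * (s * u + t * v) = q := by linear_combination h3 + h1 - h5
  have c1 : 4 * (r * u - p * v) ^ 2 = 3 * q ^ 2 := by
    linear_combination 4 * (p ^ 2 + r ^ 2) * h1 + 4 * q * h2 - (2 * (p * u + r * v) + q) * e1
  have c2 : 4 * (t * u - s * v) ^ 2 = 3 * q ^ 2 := by
    linear_combination 4 * (s ^ 2 + t ^ 2) * h1 + 4 * q * h3 - (2 * (s * u + t * v) + q) * e2
  have hA : (p - s) * u + (r - t) * v = 0 := by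
    have : (2 : F) * ((p - s) * u + (r - t) * v) = 0 := by linear_combination e1 - e2
    simpa using this
  have hprod : ((r * u - p * v) - (t * u - s * v)) * ((r * u - p * v) + (t * u - s * v)) = 0 := by
    have : (4 : F) * (((r * u - p * v) - (t * u - s * v)) *
      ((r * u - p * v) + (t * u - s * v))) = 0 := by linear_combination c1 - c2
    simpa using this
  rcases mul_eq_zero.1 hprod with h | h
  · left
    constructor
    · have : q * (p - s) = 0 := by linear_combination u * hA - v * h - (p - s) * h1
      simpa [hq, sub_eq_zero] using this
    · have : q * (r - t) = 0 := by linear_combination v * hA + u * h - (r - t) * h1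
      simpa [hq, sub_eq_zero] using this
  · right
    apply mul_left_cancel₀ hq
    have hB : (r - t) * u - (p - s) * v = 2 * (r * u - p * v) := by linear_combination -h
    linear_combination -((p - s) ^ 2 + (r - t) ^ 2) * h1 + ((p - s) * u + (r - t) * v) * hA +
      ((r - t) * u - (p - s) * v + 2 * (r * u - p * v)) * hB + c1

lemma rhombus {F : Type*} [Field F] [CharZero F] {d : ℝ} {q : ℚ} (hd : 0 < d) (hq : (q : F) ≠ 0)
    (h : ∀ x y : EuclideanSpace ℝ (Fin 2), dist x y = d →
      ∃ S : Finset (EuclideanSpace ℝ (Fin 2)), 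
        ∀ f : EuclideanSpace ℝ (Fin 2) → (Fin 2 → F),
          (∀ u ∈ S, ∀ v ∈ S, dist u v = 1 → ∑ i, (f u i - f v i) ^ 2 = 1) →
          (f x 0 - f y 0) ^ 2 + (f x 1 - f y 1) ^ 2 = (q : F))
    (x y : EuclideanSpace ℝ (Fin 2)) (hxy : (x 0 - y 0) ^ 2 + (x 1 - y 1) ^ 2 = 3 * d ^ 2) :
    ∃ S : Finset (EuclideanSpace ℝ (Fin 2)), 
        ∀ f : EuclideanSpace ℝ (Fin 2) → (Fin 2 → F),
          (∀ u ∈ S, ∀ v ∈ S, dist u v = 1 → ∑ i, (f u i - f v i) ^ 2 = 1) →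
          (f x 0 = f y 0 ∧ f x 1 = f y 1) ∨
          (f x 0 - f y 0) ^ 2 + (f x 1 - f y 1) ^ 2 = 3 * (q : F) := by
  classical
  obtain ⟨c, hc⟩ : ∃ c : ℝ, c ^ 2 = 1 / 12 := ⟨√(1 / 12), Real.sq_sqrt (by norm_num)⟩
  let a : EuclideanSpace ℝ (Fin 2) :=
    !₂[(x 0 + y 0) / 2 - c * (y 1 - x 1), (x 1 + y 1) / 2 + c * (y 0 - x 0)]
  let b : EuclideanSpace ℝ (Fin 2) :=
    !₂[(x 0 + y 0) / 2 + c * (y 1 - x 1), (x 1 + y 1) / 2 - c * (y 0 - x 0)]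
  have a0 : a 0 = (x 0 + y 0) / 2 - c * (y 1 - x 1) := by simp [a]
  have a1 : a 1 = (x 1 + y 1) / 2 + c * (y 0 - x 0) := by simp [a]
  have b0 : b 0 = (x 0 + y 0) / 2 + c * (y 1 - x 1) := by simp [b]
  have b1 : b 1 = (x 1 + y 1) / 2 - c * (y 0 - x 0) := by simp [b]
  have k := congrArg (· * ((x 0 - y 0) ^ 2 + (x 1 - y 1) ^ 2)) hc
  simp only at k
  obtain ⟨S1, H1⟩ := h b a ((dist_two hd).2 (by
    rw [a0, a1, b0, b1]; linear_combination 4 * k + hxy / 3))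
  obtain ⟨S2, H2⟩ := h x a ((dist_two hd).2 (by
    rw [a0, a1]; linear_combination k + hxy / 3))
  obtain ⟨S3, H3⟩ := h y a ((dist_two hd).2 (by
    rw [a0, a1]; linear_combination k + hxy / 3))
  obtain ⟨S4, H4⟩ := h x b ((dist_two hd).2 (by
    rw [b0, b1]; linear_combination k + hxy / 3))
  obtain ⟨S5, H5⟩ := h y b ((dist_two hd).2 (by
    rw [b0, b1]; linear_combination k + hxy / 3))
  refine ⟨S1 ∪ S2 ∪ S3 ∪ S4 ∪ S5, fun f hf => ?_⟩
  have g1 := H1 f (fun u hu v hv => hf u (by simp [hu]) v (by simp [hv]))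
  have g2 := H2 f (fun u hu v hv => hf u (by simp [hu]) v (by simp [hv]))
  have g3 := H3 f (fun u hu v hv => hf u (by simp [hu]) v (by simp [hv]))
  have g4 := H4 f (fun u hu v hv => hf u (by simp [hu]) v (by simp [hv]))
  have g5 := H5 f (fun u hu v hv => hf u (by simp [hu]) v (by simp [hv]))
  rcases rhombus_alg hq g1 g2 g3 (by linear_combination g4) (by linear_combination g5) with
    ⟨e, e'⟩ | e
  · left
    exact ⟨by linear_combination e, by linear_combination e'⟩
  · right
    linear_combination e

/-- **Lemma 1.** If `d ∈ D₂(F)` then `√3 · d ∈ D₂(F)`. -/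
theorem stmt_11 (F : Type*) [Field F] [CharZero F] (d : ℝ) (hd : MemD2 F d) :
    MemD2 F (Real.sqrt 3 * d) := by
  classical
  obtain ⟨hd0, q, hq, h⟩ := hd
  have h' := forced_total h
  have hq0 : q ≠ 0 := by
    rintro rfl
    have : 0 < d ^ 2 := by positivity
    rw [← hq] at this
    simp at this
  have hqF : (q : F) ≠ 0 := by exact_mod_cast hq0
  have h3 : (√3 * d) ^ 2 = 3 * d ^ 2 := by rw [mul_pow, Real.sq_sqrt (by norm_num)]
  refine ⟨by positivity, 3 * q, by rw [h3]; push_cast; rw [hq], fun x y hxy => ?_⟩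
  rw [dist_two (by positivity), h3] at hxy
  obtain ⟨c, hc⟩ : ∃ c : ℝ, c ^ 2 = 11 / 36 := ⟨√(11 / 36), Real.sq_sqrt (by norm_num)⟩
  let z : EuclideanSpace ℝ (Fin 2) :=
    !₂[x 0 + 5 / 6 * (y 0 - x 0) - c * (y 1 - x 1), x 1 + 5 / 6 * (y 1 - x 1) + c * (y 0 - x 0)]
  have z0 : z 0 = x 0 + 5 / 6 * (y 0 - x 0) - c * (y 1 - x 1) := by simp [z]
  have z1 : z 1 = x 1 + 5 / 6 * (y 1 - x 1) + c * (y 0 - x 0) := by simp [z]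
  have k := congrArg (· * ((x 0 - y 0) ^ 2 + (x 1 - y 1) ^ 2)) hc
  simp only at k
  obtain ⟨S1, H1⟩ := rhombus hd0 hqF h' x y hxy
  obtain ⟨S2, H2⟩ := rhombus hd0 hqF h' x z (by
    rw [z0, z1]; linear_combination k + hxy)
  obtain ⟨S3, H3⟩ := h' y z ((dist_two hd0).2 (by
    rw [z0, z1]; linear_combination k + hxy / 3))
  obtain ⟨S, hS⟩ : ∃ S : Finset (EuclideanSpace ℝ (Fin 2)), S = {x, y} ∪ S1 ∪ S2 ∪ S3 := ⟨_, rfl⟩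
  have hxS : x ∈ S := by simp [hS]
  have hyS : y ∈ S := by simp [hS]
  refine ⟨S, hxS, hyS, fun f hf => ?_⟩
  let g : EuclideanSpace ℝ (Fin 2) → (Fin 2 → F) := fun u => if hu : u ∈ S then f ⟨u, hu⟩ else 0
  have gS : ∀ u (hu : u ∈ S), g u = f ⟨u, hu⟩ := fun u hu => by simp [g, hu]
  have hg : ∀ u ∈ S, ∀ v ∈ S, dist u v = 1 → ∑ i, (g u i - g v i) ^ 2 = 1 := by
    intro u hu v hv huv
    rw [gS u hu, gS v hv]
    exact hf ⟨u, hu⟩ ⟨v, hv⟩ huv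
  have g1 := H1 g (fun u hu v hv => hg u (by simp [hS, hu]) v (by simp [hS, hv]))
  have g2 := H2 g (fun u hu v hv => hg u (by simp [hS, hu]) v (by simp [hS, hv]))
  have g3 := H3 g (fun u hu v hv => hg u (by simp [hS, hu]) v (by simp [hS, hv]))
  rw [← gS x, ← gS y, Fin.sum_univ_two]
  push_cast
  rcases g1 with ⟨e, e'⟩ | e
  · exfalso
    rw [← e, ← e'] at g3
    rcases g2 with ⟨w, w'⟩ | w
    · rw [w, w'] at g3
      apply hqF
      rw [← g3]; ring
    · rw [g3] at w
      apply hqF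
      have : (2 : F) * q = 0 := by linear_combination -w
      simpa using this
  · exact e
end

section
/- Let F be a field of characteristic 0 and d > 0 a real number in D₂(F). Then 2d ∈ D₂(F) (Lemma 2). -/
namespace BQ

abbrev E := EuclideanSpace ℝ (Fin 2)

def phi {F : Type*} [Field F] (a b : Fin 2 → F) : F := ∑ i, (a i - b i) ^ 2

def Pres {F : Type*} [Field F] (S : Finset E) (f : E → Fin 2 → F) : Prop :=
  ∀ u ∈ S, ∀ v ∈ S, dist u v = 1 → phi (f u) (f v) = 1

lemma Pres.mono {F : Type*} [Field F] {S T : Finset E} {f : E → Fin 2 → F}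
    (h : Pres T f) (hs : S ⊆ T) : Pres S f :=
  fun u hu v hv huv => h u (hs hu) v (hs hv) huv

lemma Pres.left {F : Type*} [Field F] {S T : Finset E} {f : E → Fin 2 → F}
    (h : Pres (S ∪ T) f) : Pres S f := h.mono Finset.subset_union_left

lemma Pres.right {F : Type*} [Field F] {S T : Finset E} {f : E → Fin 2 → F}
    (h : Pres (S ∪ T) f) : Pres T f := h.mono Finset.subset_union_right

/-- distance `d` is sent to the value `q` -/
def Q (F : Type*) [Field F] (d : ℝ) (q : F) : Prop :=
  ∀ x y : E, dist x y = d → ∃ S : Finset E, ∀ f : E → Fin 2 → F, Pres S f → phi (f x) (f y) = q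

/-- the point `x + a v + b J v`, `v = y - x` -/
noncomputable def g (x y : E) (a b : ℝ) : E :=
  !₂[x 0 + a * (y 0 - x 0) - b * (y 1 - x 1), x 1 + a * (y 1 - x 1) + b * (y 0 - x 0)]

lemma g_zero (x y : E) : g x y 0 0 = x := by
  ext i; fin_cases i <;> simp [g]

lemma g_one (x y : E) : g x y 1 0 = y := by
  ext i; fin_cases i <;> simp [g]

lemma dist_g (x y : E) (a b a' b' L r : ℝ) (hL : dist x y = L) (hr : 0 ≤ r)
    (h : ((a - a') ^ 2 + (b - b') ^ 2) * L ^ 2 = r ^ 2) :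
    dist (g x y a b) (g x y a' b') = r := by
  have h1 : L ^ 2 = (x 0 - y 0) ^ 2 + (x 1 - y 1) ^ 2 := by
    rw [← hL, EuclideanSpace.dist_eq, Real.sq_sqrt (by positivity)]
    simp [Fin.sum_univ_two, Real.dist_eq]
  rw [EuclideanSpace.dist_eq, ← Real.sqrt_sq hr]
  congr 1
  rw [← h, h1]
  simp only [Fin.sum_univ_two, Real.dist_eq, sq_abs, g]
  simp
  ring

lemma dist_zero_g (x y : E) (a b L r : ℝ) (hL : dist x y = L) (hr : 0 ≤ r)
    (h : ((0 - a) ^ 2 + (0 - b) ^ 2) * L ^ 2 = r ^ 2) : dist x (g x y a b) = r := by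
  have := dist_g x y 0 0 a b L r hL hr h
  rwa [g_zero] at this

lemma dist_one_g (x y : E) (a b L r : ℝ) (hL : dist x y = L) (hr : 0 ≤ r)
    (h : ((1 - a) ^ 2 + (0 - b) ^ 2) * L ^ 2 = r ^ 2) : dist y (g x y a b) = r := by
  have := dist_g x y 1 0 a b L r hL hr h
  rwa [g_one] at this

lemma dist_g_one (x y : E) (a b L r : ℝ) (hL : dist x y = L) (hr : 0 ≤ r)
    (h : ((a - 1) ^ 2 + (b - 0) ^ 2) * L ^ 2 = r ^ 2) : dist (g x y a b) y = r := by
  have := dist_g x y a b 1 0 L r hL hr h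
  rwa [g_one] at this

lemma alg {F : Type*} [Field F] [CharZero F] (x c a b : Fin 2 → F) (q : F) (hq : q ≠ 0)
    (h1 : phi x a = q) (h2 : phi x b = q) (h3 : phi a b = q) (h4 : phi a c = q)
    (h5 : phi b c = q) :
    x = c ∨ ((∀ i, c i = a i + b i - x i) ∧ phi x c = 3 * q) := by
  simp only [phi, Fin.sum_univ_two] at *
  obtain ⟨a0, ha0⟩ : ∃ t, t = a 0 - x 0 := ⟨_, rfl⟩
  obtain ⟨a1, ha1⟩ : ∃ t, t = a 1 - x 1 := ⟨_, rfl⟩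
  obtain ⟨b0, hb0⟩ : ∃ t, t = b 0 - x 0 := ⟨_, rfl⟩
  obtain ⟨b1, hb1⟩ : ∃ t, t = b 1 - x 1 := ⟨_, rfl⟩
  obtain ⟨c0, hc0⟩ : ∃ t, t = c 0 - x 0 := ⟨_, rfl⟩
  obtain ⟨c1, hc1⟩ : ∃ t, t = c 1 - x 1 := ⟨_, rfl⟩
  have e1 : a0 ^ 2 + a1 ^ 2 = q := by rw [ha0, ha1]; linear_combination h1
  have e2 : b0 ^ 2 + b1 ^ 2 = q := by rw [hb0, hb1]; linear_combination h2
  have e3 : 2 * (a0 * b0 + a1 * b1) = q := by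
    rw [ha0, ha1, hb0, hb1]; linear_combination h1 + h2 - h3
  obtain ⟨k, hk⟩ : ∃ k, k = c0 ^ 2 + c1 ^ 2 := ⟨_, rfl⟩
  have e4 : 2 * (a0 * c0 + a1 * c1) = k := by
    rw [hk, ha0, ha1, hc0, hc1]; linear_combination h1 - h4
  have e5 : 2 * (b0 * c0 + b1 * c1) = k := by
    rw [hk, hb0, hb1, hc0, hc1]; linear_combination h2 - h5
  obtain ⟨D, hD⟩ : ∃ D, D = a0 * b1 - a1 * b0 := ⟨_, rfl⟩
  have hD2 : 4 * D ^ 2 = 3 * q ^ 2 := by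
    rw [hD]
    linear_combination 4 * (b0 ^ 2 + b1 ^ 2) * e1 + 4 * q * e2 - (2 * (a0 * b0 + a1 * b1) + q) * e3
  have hD0 : D ≠ 0 := by
    rintro rfl
    have : q ^ 2 = 0 := by linear_combination -hD2 / 3
    exact hq (by simpa using this)
  have u0 : 2 * D * c0 = k * (b1 - a1) := by
    rw [hD]; linear_combination b1 * e4 - a1 * e5
  have u1 : 2 * D * c1 = k * (a0 - b0) := by
    rw [hD]; linear_combination a0 * e5 - b0 * e4
  have w0 : 2 * D * (a0 + b0) = 3 * q * (b1 - a1) := by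
    rw [hD]; linear_combination (2*b1) * e1 - (2*a1) * e2 + (b1-a1) * e3
  have w1 : 2 * D * (a1 + b1) = 3 * q * (a0 - b0) := by
    rw [hD]; linear_combination (-2*b0) * e1 + (2*a0) * e2 + (a0-b0) * e3
  have hkk : k * (k - 3 * q) = 0 := by
    have : q * (k * (k - 3 * q)) = 0 := by
      linear_combination (-(2 * D * c0) - k * (b1 - a1)) * u0 + (-(2 * D * c1) - k * (a0 - b0)) * u1 - k^2 * (e1 + e2 - e3) - 4 * D^2 * hk + k * hD2
    exact (mul_eq_zero.1 this).resolve_left hq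
  have h2D : 2 * D ≠ 0 := mul_ne_zero two_ne_zero hD0
  rcases mul_eq_zero.1 hkk with hz | hz
  · left
    have z0 : c0 = 0 := by
      apply (mul_eq_zero.1 (_ : 2 * D * c0 = 0)).resolve_left h2D
      rw [u0, hz, zero_mul]
    have z1 : c1 = 0 := by
      apply (mul_eq_zero.1 (_ : 2 * D * c1 = 0)).resolve_left h2D
      rw [u1, hz, zero_mul]
    ext i; fin_cases i
    · show x 0 = c 0
      linear_combination hc0 - z0
    · show x 1 = c 1
      linear_combination hc1 - z1
  · right
    have z0 : c0 = a0 + b0 := by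
      apply mul_left_cancel₀ h2D
      linear_combination u0 - w0 + (b1 - a1) * hz
    have z1 : c1 = a1 + b1 := by
      apply mul_left_cancel₀ h2D
      linear_combination u1 - w1 + (a0 - b0) * hz
    refine ⟨?_, ?_⟩
    · intro i; fin_cases i
      · show c 0 = a 0 + b 0 - x 0
        linear_combination z0 - hc0 + ha0 + hb0
      · show c 1 = a 1 + b 1 - x 1
        linear_combination z1 - hc1 + ha1 + hb1
    · rw [hc0, hc1] at hk
      linear_combination hz - hk

lemma phi_self {F : Type*} [Field F] (a : Fin 2 → F) : phi a a = 0 := by simp [phi]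

lemma rhombus_s12 {F : Type*} [Field F] [CharZero F] {d : ℝ} {q : F} (hd : 0 < d) (hq : q ≠ 0)
    (h : Q F d q) (x y : E) (hxy : dist x y = √3 * d) :
    ∃ S : Finset E, ∀ f : E → Fin 2 → F, Pres S f → f x = f y ∨ phi (f x) (f y) = 3 * q := by
  classical
  have h3 : √3 ^ 2 = 3 := Real.sq_sqrt (by norm_num)
  obtain ⟨S1, H1⟩ := h x (g x y (1/2) (√3/6)) (by
    refine dist_zero_g x y _ _ _ _ hxy hd.le (by rw [mul_pow, h3]; linear_combination (1/12) * d^2 * h3))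
  obtain ⟨S2, H2⟩ := h x (g x y (1/2) (-(√3/6))) (by
    refine dist_zero_g x y _ _ _ _ hxy hd.le (by rw [mul_pow, h3]; linear_combination (1/12) * d^2 * h3))
  obtain ⟨S3, H3⟩ := h (g x y (1/2) (√3/6)) (g x y (1/2) (-(√3/6)))
    (dist_g x y _ _ _ _ _ _ hxy hd.le (by rw [mul_pow, h3]; linear_combination (1/3) * d^2 * h3))
  obtain ⟨S4, H4⟩ := h (g x y (1/2) (√3/6)) y (by
    refine dist_g_one x y _ _ _ _ hxy hd.le (by rw [mul_pow, h3]; linear_combination (1/12) * d^2 * h3))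
  obtain ⟨S5, H5⟩ := h (g x y (1/2) (-(√3/6))) y (by
    refine dist_g_one x y _ _ _ _ hxy hd.le (by rw [mul_pow, h3]; linear_combination (1/12) * d^2 * h3))
  refine ⟨S1 ∪ S2 ∪ S3 ∪ S4 ∪ S5, fun f hf => ?_⟩
  rcases alg _ _ _ _ q hq (H1 f hf.left.left.left.left) (H2 f hf.left.left.left.right)
    (H3 f hf.left.left.right) (H4 f hf.left.right) (H5 f hf.right) with h' | h'
  · exact Or.inl h'
  · exact Or.inr h'.2

lemma Q_sqrt3 {F : Type*} [Field F] [CharZero F] {d : ℝ} {q : F} (hd : 0 < d) (hq : q ≠ 0)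
    (h : Q F d q) : Q F (√3 * d) (3 * q) := by
  classical
  intro x y hxy
  have h3 : √3 ^ 2 = 3 := Real.sq_sqrt (by norm_num)
  have h11 : √11 ^ 2 = 11 := Real.sq_sqrt (by norm_num)
  obtain ⟨S1, H1⟩ := rhombus_s12 hd hq h x y hxy
  obtain ⟨S2, H2⟩ := rhombus_s12 hd hq h x (g x y (5/6) (√11/6)) (by
    refine dist_zero_g x y _ _ _ _ hxy (by positivity)
      (by linear_combination (1/36) * (√3*d)^2 * h11))
  obtain ⟨S3, H3⟩ := h y (g x y (5/6) (√11/6)) (by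
    refine dist_one_g x y _ _ _ _ hxy hd.le
      (by rw [mul_pow, h3]; linear_combination (1/12) * d^2 * h11))
  refine ⟨S1 ∪ S2 ∪ S3, fun f hf => ?_⟩
  rcases H1 f hf.left.left with h1 | h1
  · exfalso
    have h3' := H3 f hf.right
    rw [← h1] at h3'
    rcases H2 f hf.left.right with h2 | h2
    · rw [← h2, phi_self] at h3'
      exact hq h3'.symm
    · rw [h3'] at h2
      exact hq (by linear_combination -h2 / 2)
  · exact h1

lemma Q_two {F : Type*} [Field F] [CharZero F] {d : ℝ} {q : F} (hd : 0 < d) (hq : q ≠ 0)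
    (h : Q F d q) : Q F (2 * d) (4 * q) := by
  classical
  intro x y hxy
  have h3 : √3 ^ 2 = 3 := Real.sq_sqrt (by norm_num)
  have hh := Q_sqrt3 hd hq h
  have key : ∀ a b a' b' : ℝ, (a - a') ^ 2 + (b - b') ^ 2 = 1 / 4 →
      dist (g x y a b) (g x y a' b') = d := fun a b a' b' e =>
    dist_g x y _ _ _ _ _ _ hxy hd.le (by rw [e]; ring)
  have key' : ∀ a b a' b' : ℝ, (a - a') ^ 2 + (b - b') ^ 2 = 3 / 4 →
      dist (g x y a b) (g x y a' b') = √3 * d := fun a b a' b' e =>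
    dist_g x y _ _ _ _ _ _ hxy (by positivity) (by rw [e]; linear_combination -d ^ 2 * h3)
  obtain ⟨S1, H1⟩ := h _ _ (key 0 0 (1/2) 0 (by norm_num))
  obtain ⟨S2, H2⟩ := h _ _ (key 0 0 (1/4) (√3/4) (by linear_combination h3 / 16))
  obtain ⟨S3, H3⟩ := h _ _ (key (1/2) 0 (1/4) (√3/4) (by linear_combination h3 / 16))
  obtain ⟨S4, H4⟩ := h _ _ (key (1/2) 0 (3/4) (√3/4) (by linear_combination h3 / 16))
  obtain ⟨S5, H5⟩ := h _ _ (key (1/4) (√3/4) (3/4) (√3/4) (by norm_num))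
  obtain ⟨S6, H6⟩ := h _ _ (key (1/2) 0 1 0 (by norm_num))
  obtain ⟨S7, H7⟩ := h _ _ (key (3/4) (√3/4) 1 0 (by linear_combination h3 / 16))
  obtain ⟨S8, H8⟩ := hh _ _ (key' 0 0 (3/4) (√3/4) (by linear_combination h3 / 16))
  obtain ⟨S9, H9⟩ := hh _ _ (key' (1/4) (√3/4) 1 0 (by linear_combination h3 / 16))
  rw [g_zero] at H1 H2 H8
  rw [g_one] at H6 H7 H9
  refine ⟨S1 ∪ (S2 ∪ (S3 ∪ (S4 ∪ (S5 ∪ (S6 ∪ (S7 ∪ (S8 ∪ S9))))))), fun f hf => ?_⟩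
  replace H1 := H1 f hf.left
  replace H2 := H2 f hf.right.left
  replace H3 := H3 f hf.right.right.left
  replace H4 := H4 f hf.right.right.right.left
  replace H5 := H5 f hf.right.right.right.right.left
  replace H6 := H6 f hf.right.right.right.right.right.left
  replace H7 := H7 f hf.right.right.right.right.right.right.left
  replace H8 := H8 f hf.right.right.right.right.right.right.right.left
  replace H9 := H9 f hf.right.right.right.right.right.right.right.right
  have h3q : (3 : F) * q ≠ 0 := mul_ne_zero three_ne_zero hq
  have comm : ∀ a b : Fin 2 → F, phi a b = phi b a := fun a b => by
    simp only [phi, Fin.sum_univ_two]; ring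
  rcases alg _ _ _ _ q hq H1 H2 H3 H4 H5 with e | ⟨e, -⟩
  · rw [e, phi_self] at H8
    exact absurd H8.symm h3q
  rcases alg _ _ _ _ q hq ((comm _ _).trans H3) H5 H4 H6 H7 with e' | ⟨e', -⟩
  · rw [e', phi_self] at H9
    exact absurd H9.symm h3q
  simp only [phi, Fin.sum_univ_two] at H1 ⊢
  rw [e' 0, e' 1, e 0, e 1]
  linear_combination 4 * H1

end BQ

/-- **Lemma 2.** If `d ∈ D₂(F)` then `2 · d ∈ D₂(F)`. -/
theorem stmt_12 (F : Type*) [Field F] [CharZero F] (d : ℝ) (hd : MemD2 F d) :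
    MemD2 F (2 * d) := by
  classical
  obtain ⟨hd0, q, hq, H⟩ := hd
  have hq0 : (q : F) ≠ 0 := by
    have : (q : ℝ) ≠ 0 := by rw [hq]; positivity
    exact_mod_cast this
  have hQ : BQ.Q F d (q : F) := by
    intro x y hxy
    obtain ⟨S, hx, hy, h⟩ := H x y hxy
    refine ⟨S, fun f hf => ?_⟩
    exact h (fun u => f u) (fun u v huv => hf u u.2 v v.2 huv)
  refine ⟨by positivity, 4 * q, by push_cast; rw [hq]; ring, fun x y hxy => ?_⟩
  obtain ⟨S, h⟩ := BQ.Q_two hd0 hq0 hQ x y hxy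
  refine ⟨insert x (insert y S), by simp, by simp, fun f hf => ?_⟩
  have := h (fun u => if hu : u ∈ insert x (insert y S) then f ⟨u, hu⟩ else 0) ?_
  · simp only [BQ.phi, Finset.mem_insert, true_or, or_true, dite_true] at this
    push_cast
    exact this
  · intro u hu v hv huv
    have hu' : u ∈ insert x (insert y S) := by simp [hu]
    have hv' : v ∈ insert x (insert y S) := by simp [hv]
    simp only [BQ.phi, hu', hv', dite_true]
    exact hf ⟨u, hu'⟩ ⟨v, hv'⟩ huv
end

section
/- Let F be a field of characteristic 0 and a, b real numbers in D₂(F) with a > b. Then √(a² − b²) ∈ D₂(F) (Lemma 3). -/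
abbrev EE := EuclideanSpace ℝ (Fin 2)

def phi {F : Type*} [Field F] (x y : Fin 2 → F) : F := (x 0 - y 0) ^ 2 + (x 1 - y 1) ^ 2

def Pres {F : Type*} [Field F] (S : Finset EE) (f : EE → (Fin 2 → F)) : Prop :=
  ∀ u ∈ S, ∀ v ∈ S, dist u v = 1 → phi (f u) (f v) = 1

def Ev (F : Type*) [Field F] (P : (EE → (Fin 2 → F)) → Prop) : Prop :=
  ∀ᶠ S : Finset EE in Filter.atTop, ∀ f : EE → (Fin 2 → F), Pres S f → P f

def Good (F : Type*) [Field F] (d : ℝ) (q : ℚ) : Prop :=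
  ∀ x y : EE, dist x y = d → Ev F (fun f => phi (f x) (f y) = (q : F))

theorem memD2_iff (F : Type*) [Field F] (d : ℝ) :
    MemD2 F d ↔ 0 < d ∧ ∃ q : ℚ, (q : ℝ) = d ^ 2 ∧ Good F d q := by
  unfold MemD2 Good Ev
  refine and_congr_right fun _ => exists_congr fun q => and_congr_right fun _ =>
    forall_congr' fun x => forall_congr' fun y => imp_congr_right fun _ => ?_
  rw [Filter.eventually_atTop]
  constructor
  · rintro ⟨S, hx, hy, h⟩
    refine ⟨S, fun T hT f hf => ?_⟩
    have := h (fun u => f u) (fun u v huv => by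
      have := hf u (hT u.2) v (hT v.2) huv
      simpa [phi, Fin.sum_univ_two] using this)
    simpa [phi, Fin.sum_univ_two] using this
  · rintro ⟨S, h⟩
    classical
    refine ⟨S ∪ {x, y}, by simp, by simp, fun f hf => ?_⟩
    have := h (S ∪ {x, y}) Finset.subset_union_left
      (fun u => if hu : u ∈ S ∪ {x, y} then f ⟨u, hu⟩ else 0) (by
        intro u hu v hv huv
        have := hf ⟨u, hu⟩ ⟨v, hv⟩ huv
        simp only [hu, hv, dif_pos]
        simpa only [phi, Fin.sum_univ_two] using this)
    have hx : x ∈ S ∪ {x, y} := by simp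
    have hy : y ∈ S ∪ {x, y} := by simp
    simp only [hx, hy, dif_pos] at this
    simpa only [phi, Fin.sum_univ_two] using this

theorem Ev.and {F : Type*} [Field F] {P Q : (EE → (Fin 2 → F)) → Prop}
    (h : Ev F P) (h' : Ev F Q) : Ev F (fun f => P f ∧ Q f) := by
  unfold Ev at *
  filter_upwards [h, h'] with S h1 h2 f hf
  exact ⟨h1 f hf, h2 f hf⟩

theorem Ev.mono {F : Type*} [Field F] {P Q : (EE → (Fin 2 → F)) → Prop}
    (h : Ev F P) (h' : ∀ f, P f → Q f) : Ev F Q := by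
  unfold Ev at *
  filter_upwards [h] with S h1 f hf
  exact h' f (h1 f hf)

theorem dist_iff (x y : EE) (d : ℝ) (hd : 0 ≤ d) :
    dist x y = d ↔ (x 0 - y 0) ^ 2 + (x 1 - y 1) ^ 2 = d ^ 2 := by
  rw [EuclideanSpace.dist_eq, Fin.sum_univ_two, Real.dist_eq, Real.dist_eq, sq_abs, sq_abs,
    Real.sqrt_eq_iff_eq_sq (by positivity) hd]

/-- Points equidistant from two points lie on a line. -/
theorem kite {F : Type*} [Field F] [CharZero F] (p p' : Fin 2 → F) (h : phi p p' ≠ 0) :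
    ∃ t : (Fin 2 → F) → F, ∀ x, phi x p = phi x p' →
      phi x p = phi p p' / 4 + (t x) ^ 2 * phi p p' ∧
      ∀ y, phi y p = phi y p' → phi x y = (t x - t y) ^ 2 * phi p p' ∧ (t x = t y → x = y) := by
  have key : ∀ x, phi x p = phi x p' → ∃ t : F,
      x 0 = (p 0 + p' 0) / 2 - t * (p' 1 - p 1) ∧ x 1 = (p 1 + p' 1) / 2 + t * (p' 0 - p 0) := by
    intro x hx
    refine ⟨(-(x 0 - (p 0 + p' 0) / 2) * (p' 1 - p 1) + (x 1 - (p 1 + p' 1) / 2) * (p' 0 - p 0))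
      / phi p p', ?_, ?_⟩
    · field_simp
      unfold phi at *
      linear_combination (p' 0 - p 0) * hx
    · field_simp
      unfold phi at *
      linear_combination (p' 1 - p 1) * hx
  classical
  choose t ht using key
  obtain ⟨T, hT⟩ : ∃ T : (Fin 2 → F) → F, ∀ x, phi x p = phi x p' →
      x 0 = (p 0 + p' 0) / 2 - T x * (p' 1 - p 1) ∧
      x 1 = (p 1 + p' 1) / 2 + T x * (p' 0 - p 0) := by
    refine ⟨fun x => if hx : phi x p = phi x p' then t x hx else 0, fun x hx => ?_⟩
    beta_reduce
    rw [dif_pos hx]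
    exact ht x hx
  refine ⟨T, fun x hx => ?_⟩
  obtain ⟨h0, h1⟩ := hT x hx
  constructor
  · unfold phi; rw [h0, h1]; field_simp; ring
  · intro y hy
    obtain ⟨h0', h1'⟩ := hT y hy
    constructor
    · unfold phi; rw [h0, h1, h0', h1']; ring
    · intro hxy
      ext i
      fin_cases i
      · simp [h0, h0', hxy]
      · simp [h1, h1', hxy]

theorem good_sqrt3_aux {F : Type*} [Field F] [CharZero F] {d : ℝ} {q : ℚ} (hd : 0 < d)
    (hq : (q : F) ≠ 0) (h : Good F d q) (x y : EE) (hxy : dist x y = √3 * d) :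
    Ev F (fun f => f x = f y ∨ phi (f x) (f y) = 3 * (q : F)) := by
  have h3 : √3 ^ 2 = 3 := Real.sq_sqrt (by norm_num)
  rw [dist_iff _ _ _ (by positivity), mul_pow, h3] at hxy
  obtain ⟨p, hp⟩ : ∃ p : EE, p = !₂[(x 0 + y 0) / 2 - √3 / 6 * (y 1 - x 1),
    (x 1 + y 1) / 2 + √3 / 6 * (y 0 - x 0)] := ⟨_, rfl⟩
  obtain ⟨p', hp'⟩ : ∃ p : EE, p = !₂[(x 0 + y 0) / 2 + √3 / 6 * (y 1 - x 1),
    (x 1 + y 1) / 2 - √3 / 6 * (y 0 - x 0)] := ⟨_, rfl⟩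
  have hp0 : p 0 = (x 0 + y 0) / 2 - √3 / 6 * (y 1 - x 1) := by simp [hp]
  have hp1 : p 1 = (x 1 + y 1) / 2 + √3 / 6 * (y 0 - x 0) := by simp [hp]
  have hp0' : p' 0 = (x 0 + y 0) / 2 + √3 / 6 * (y 1 - x 1) := by simp [hp']
  have hp1' : p' 1 = (x 1 + y 1) / 2 - √3 / 6 * (y 0 - x 0) := by simp [hp']
  set N := (x 0 - y 0) ^ 2 + (x 1 - y 1) ^ 2 with hN
  have e1 := h p p' (by
    rw [dist_iff _ _ _ hd.le, hp0, hp1, hp0', hp1']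
    linear_combination (1/3) * hxy + N / 9 * h3)
  have e2 := h x p (by
    rw [dist_iff _ _ _ hd.le, hp0, hp1]
    linear_combination (1/3) * hxy + N / 36 * h3)
  have e3 := h x p' (by
    rw [dist_iff _ _ _ hd.le, hp0', hp1']
    linear_combination (1/3) * hxy + N / 36 * h3)
  have e4 := h y p (by
    rw [dist_iff _ _ _ hd.le, hp0, hp1]
    linear_combination (1/3) * hxy + N / 36 * h3)
  have e5 := h y p' (by
    rw [dist_iff _ _ _ hd.le, hp0', hp1']
    linear_combination (1/3) * hxy + N / 36 * h3)
  refine (e1.and (e2.and (e3.and (e4.and e5)))).mono ?_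
  rintro f ⟨e1, e2, e3, e4, e5⟩
  obtain ⟨t, ht⟩ := kite (f p) (f p') (by rw [e1]; exact hq)
  obtain ⟨a1, a2⟩ := ht _ (e2.trans e3.symm)
  obtain ⟨b1, -⟩ := ht _ (e4.trans e5.symm)
  obtain ⟨a3, a4⟩ := a2 _ (e4.trans e5.symm)
  rw [e1, e2] at a1
  rw [e1, e4] at b1
  rw [e1] at a3
  have A : t (f x) ^ 2 = 3 / 4 := mul_right_cancel₀ hq (by linear_combination -a1)
  have B : t (f y) ^ 2 = t (f x) ^ 2 := mul_right_cancel₀ hq (by linear_combination a1 - b1)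
  rcases sq_eq_sq_iff_eq_or_eq_neg.1 B with B | B
  · left; exact a4 B.symm
  · right; rw [a3, B]; linear_combination 4 * (q : F) * A

theorem good_sqrt3 {F : Type*} [Field F] [CharZero F] {d : ℝ} {q : ℚ} (hd : 0 < d)
    (hq : (q : F) ≠ 0) (h : Good F d q) : Good F (√3 * d) (3 * q) := by
  intro x y hxy
  have h3 : √3 ^ 2 = 3 := Real.sq_sqrt (by norm_num)
  have h11 : √11 ^ 2 = 11 := Real.sq_sqrt (by norm_num)
  have f1 := good_sqrt3_aux hd hq h x y hxy
  rw [dist_iff _ _ _ (by positivity), mul_pow, h3] at hxy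
  obtain ⟨p, hp⟩ : ∃ p : EE, p = !₂[x 0 + 5 / 6 * (y 0 - x 0) - √11 / 6 * (y 1 - x 1),
    x 1 + 5 / 6 * (y 1 - x 1) + √11 / 6 * (y 0 - x 0)] := ⟨_, rfl⟩
  have hp0 : p 0 = x 0 + 5 / 6 * (y 0 - x 0) - √11 / 6 * (y 1 - x 1) := by simp [hp]
  have hp1 : p 1 = x 1 + 5 / 6 * (y 1 - x 1) + √11 / 6 * (y 0 - x 0) := by simp [hp]
  set N := (x 0 - y 0) ^ 2 + (x 1 - y 1) ^ 2 with hN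
  have f2 := good_sqrt3_aux hd hq h x p (by
    rw [dist_iff _ _ _ (by positivity), mul_pow, h3, hp0, hp1]
    linear_combination hxy + N / 36 * h11)
  have f3 := h y p (by
    rw [dist_iff _ _ _ hd.le, hp0, hp1]
    linear_combination (1/3) * hxy + N / 36 * h11)
  refine (f1.and (f2.and f3)).mono ?_
  rintro f ⟨f1, f2, f3⟩
  push_cast
  rcases f1 with f1 | f1
  · exfalso
    rw [← f1] at f3
    rcases f2 with f2 | f2
    · rw [← f2] at f3
      apply hq
      rw [← f3]
      simp [phi]
    · apply hq
      linear_combination (1/2) * f3 - (1/2) * f2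
  · exact f1

theorem good_two {F : Type*} [Field F] [CharZero F] {d : ℝ} {q : ℚ} (hd : 0 < d)
    (hq : (q : F) ≠ 0) (h : Good F d q) : Good F (2 * d) (4 * q) := by
  have h' := good_sqrt3 hd hq h
  intro x y hxy
  have h3 : √3 ^ 2 = 3 := Real.sq_sqrt (by norm_num)
  have hd' : 0 ≤ √3 * d := by positivity
  rw [dist_iff _ _ _ (by positivity), mul_pow] at hxy
  obtain ⟨m, hm⟩ : ∃ p : EE, p = !₂[(x 0 + y 0) / 2, (x 1 + y 1) / 2] := ⟨_, rfl⟩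
  obtain ⟨p, hp⟩ : ∃ p : EE, p = !₂[(3 * x 0 + y 0) / 4 - √3 / 4 * (y 1 - x 1),
    (3 * x 1 + y 1) / 4 + √3 / 4 * (y 0 - x 0)] := ⟨_, rfl⟩
  obtain ⟨p', hp'⟩ : ∃ p : EE, p = !₂[(3 * x 0 + y 0) / 4 + √3 / 4 * (y 1 - x 1),
    (3 * x 1 + y 1) / 4 - √3 / 4 * (y 0 - x 0)] := ⟨_, rfl⟩
  have hm0 : m 0 = (x 0 + y 0) / 2 := by simp [hm]
  have hm1 : m 1 = (x 1 + y 1) / 2 := by simp [hm]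
  have hp0 : p 0 = (3 * x 0 + y 0) / 4 - √3 / 4 * (y 1 - x 1) := by simp [hp]
  have hp1 : p 1 = (3 * x 1 + y 1) / 4 + √3 / 4 * (y 0 - x 0) := by simp [hp]
  have hp0' : p' 0 = (3 * x 0 + y 0) / 4 + √3 / 4 * (y 1 - x 1) := by simp [hp']
  have hp1' : p' 1 = (3 * x 1 + y 1) / 4 - √3 / 4 * (y 0 - x 0) := by simp [hp']
  set N := (x 0 - y 0) ^ 2 + (x 1 - y 1) ^ 2 with hN
  have e1 := h' p p' (by
    rw [dist_iff _ _ _ hd', mul_pow, h3, hp0, hp1, hp0', hp1']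
    linear_combination (3/4) * hxy + N / 4 * h3)
  have e2 := h x p (by
    rw [dist_iff _ _ _ hd.le, hp0, hp1]
    linear_combination (1/4) * hxy + N / 16 * h3)
  have e3 := h x p' (by
    rw [dist_iff _ _ _ hd.le, hp0', hp1']
    linear_combination (1/4) * hxy + N / 16 * h3)
  have e4 := h m p (by
    rw [dist_iff _ _ _ hd.le, hp0, hp1, hm0, hm1]
    linear_combination (1/4) * hxy + N / 16 * h3)
  have e5 := h m p' (by
    rw [dist_iff _ _ _ hd.le, hp0', hp1', hm0, hm1]
    linear_combination (1/4) * hxy + N / 16 * h3)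
  have e6 := h' y p (by
    rw [dist_iff _ _ _ hd', mul_pow, h3, hp0, hp1]
    linear_combination (3/4) * hxy + N / 16 * h3)
  have e7 := h' y p' (by
    rw [dist_iff _ _ _ hd', mul_pow, h3, hp0', hp1']
    linear_combination (3/4) * hxy + N / 16 * h3)
  have e8 := h x m (by
    rw [dist_iff _ _ _ hd.le, hm0, hm1]
    linear_combination (1/4) * hxy)
  have e9 := h y m (by
    rw [dist_iff _ _ _ hd.le, hm0, hm1]
    linear_combination (1/4) * hxy)
  refine (e1.and (e2.and (e3.and (e4.and (e5.and (e6.and (e7.and (e8.and e9)))))))).mono ?_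
  rintro f ⟨e1, e2, e3, e4, e5, e6, e7, e8, e9⟩
  push_cast at *
  obtain ⟨t, ht⟩ := kite (f p) (f p') (by rw [e1]; exact mul_ne_zero (by norm_num) hq)
  obtain ⟨a1, a2⟩ := ht _ (e2.trans e3.symm)
  obtain ⟨b1, -⟩ := ht _ (e4.trans e5.symm)
  obtain ⟨c1, c2⟩ := ht _ (e6.trans e7.symm)
  obtain ⟨a3, a4⟩ := a2 _ (e4.trans e5.symm)
  obtain ⟨a4, -⟩ := a2 _ (e6.trans e7.symm)
  obtain ⟨c3, -⟩ := c2 _ (e4.trans e5.symm)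
  rw [e1, e2] at a1
  rw [e1, e4] at b1
  rw [e1, e6] at c1
  rw [e1, e8] at a3
  rw [e1, e9] at c3
  rw [e1] at a4
  rw [a4]
  generalize t (f x) = α at *
  generalize t (f m) = μ at *
  generalize t (f y) = β at *
  have A : α ^ 2 = 1 / 12 := mul_right_cancel₀ hq (by linear_combination (-1/3) * a1)
  have B : μ ^ 2 = α ^ 2 := mul_right_cancel₀ hq (by linear_combination (1/3) * (a1 - b1))
  have C : β ^ 2 = (3 * α) ^ 2 := by
    rw [mul_pow, A]; exact mul_right_cancel₀ hq (by linear_combination (-1/3) * c1)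
  have A3 : (α - μ) ^ 2 = 1 / 3 := mul_right_cancel₀ hq (by linear_combination (-1/3) * a3)
  have C3 : (β - μ) ^ 2 = 1 / 3 := mul_right_cancel₀ hq (by linear_combination (-1/3) * c3)
  rcases sq_eq_sq_iff_eq_or_eq_neg.1 B with rfl | rfl
  · exfalso; norm_num at A3
  rcases sq_eq_sq_iff_eq_or_eq_neg.1 C with rfl | rfl
  · exfalso
    have : (1 : F) = 0 := by linear_combination C3 - 16 * A
    exact one_ne_zero this
  · linear_combination 48 * (q : F) * A

/-- **Lemma 3.** If `a, b ∈ D₂(F)` and `a > b`, then `√(a² - b²) ∈ D₂(F)`. -/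
theorem stmt_13 (F : Type*) [Field F] [CharZero F] (a b : ℝ)
    (ha : MemD2 F a) (hb : MemD2 F b) (hab : b < a) :
    MemD2 F (Real.sqrt (a ^ 2 - b ^ 2)) := by
  rw [memD2_iff] at *
  obtain ⟨ha0, q, hq, hA⟩ := ha
  obtain ⟨hb0, r, hr, hB⟩ := hb
  have hpos : 0 < a ^ 2 - b ^ 2 := by nlinarith
  have hc : 0 < √(a ^ 2 - b ^ 2) := Real.sqrt_pos.2 hpos
  have hc2 : √(a ^ 2 - b ^ 2) ^ 2 = a ^ 2 - b ^ 2 := Real.sq_sqrt hpos.le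
  have hr0 : (r : F) ≠ 0 := by
    have : (r : ℝ) ≠ 0 := by rw [hr]; positivity
    exact_mod_cast this
  have hB2 := good_two hb0 hr0 hB
  refine ⟨hc, q - r, by rw [hc2, ← hq, ← hr]; push_cast; ring, ?_⟩
  intro x y hxy
  rw [dist_iff _ _ _ hc.le, hc2] at hxy
  obtain ⟨k, hk⟩ : ∃ k, k = b / √(a ^ 2 - b ^ 2) := ⟨_, rfl⟩
  have hk2 : k ^ 2 * (a ^ 2 - b ^ 2) = b ^ 2 := by
    rw [hk, div_pow, hc2]; field_simp
  obtain ⟨p, hp⟩ : ∃ p : EE, p = !₂[y 0 - k * (y 1 - x 1), y 1 + k * (y 0 - x 0)] := ⟨_, rfl⟩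
  obtain ⟨p', hp'⟩ : ∃ p : EE, p = !₂[y 0 + k * (y 1 - x 1), y 1 - k * (y 0 - x 0)] := ⟨_, rfl⟩
  have hp0 : p 0 = y 0 - k * (y 1 - x 1) := by simp [hp]
  have hp1 : p 1 = y 1 + k * (y 0 - x 0) := by simp [hp]
  have hp0' : p' 0 = y 0 + k * (y 1 - x 1) := by simp [hp']
  have hp1' : p' 1 = y 1 - k * (y 0 - x 0) := by simp [hp']
  have e1 := hB2 p p' (by
    rw [dist_iff _ _ _ (by positivity), hp0, hp1, hp0', hp1']
    linear_combination 4 * k ^ 2 * hxy + 4 * hk2)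
  have e2 := hA x p (by
    rw [dist_iff _ _ _ ha0.le, hp0, hp1]
    linear_combination (1 + k ^ 2) * hxy + hk2)
  have e3 := hA x p' (by
    rw [dist_iff _ _ _ ha0.le, hp0', hp1']
    linear_combination (1 + k ^ 2) * hxy + hk2)
  have e4 := hB y p (by
    rw [dist_iff _ _ _ hb0.le, hp0, hp1]
    linear_combination k ^ 2 * hxy + hk2)
  have e5 := hB y p' (by
    rw [dist_iff _ _ _ hb0.le, hp0', hp1']
    linear_combination k ^ 2 * hxy + hk2)
  refine (e1.and (e2.and (e3.and (e4.and e5)))).mono ?_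
  rintro f ⟨e1, e2, e3, e4, e5⟩
  push_cast at *
  obtain ⟨t, ht⟩ := kite (f p) (f p') (by rw [e1]; exact mul_ne_zero (by norm_num) hr0)
  obtain ⟨a1, a2⟩ := ht _ (e2.trans e3.symm)
  obtain ⟨b1, -⟩ := ht _ (e4.trans e5.symm)
  obtain ⟨a3, a4⟩ := a2 _ (e4.trans e5.symm)
  rw [e1, e2] at a1
  rw [e1, e4] at b1
  rw [e1] at a3
  rw [a3]
  have B : t (f y) ^ 2 = 0 := mul_right_cancel₀ hr0 (by linear_combination (-1/4) * b1)
  have B' : t (f y) = 0 := by simpa using B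
  rw [B']
  linear_combination -a1
end
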